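/- Let f ∈ Homeo₀(T²) with a lift f̃ such that ρ(f̃) has an extremal point of the form (p₁/q, p₂/q), where p₁, p₂, q are integers with q > 1 and gcd(p₁, p₂, q) = 1. Then the rotation set of f is not (2/√(πq))-upper-stable in Homeo₀(T²): there exist g ∈ Homeo₀(T²) and a lift g̃ of g with sup_{x∈ℝ²} ‖f̃(x) − g̃(x)‖ < 2/√(πq) and ρ(g̃) ⊄ ρ(f̃). -/

import Mathlib

noncomputable section

open Metric Set Filter Topology MeasureTheory Pointwise

/-- The plane `ℝ²` with the Euclidean metric. -/
abbrev R2 : Type := EuclideanSpace ℝ (Fin 2)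

/-- The integer lattice `ℤ² ⊂ ℝ²`. -/
def intLattice : AddSubgroup R2 where
  carrier := {v : R2 | ∀ i, ∃ n : ℤ, v i = (n : ℝ)}
  add_mem' := by
    intro a b ha hb i
    obtain ⟨m, hm⟩ := ha i
    obtain ⟨n, hn⟩ := hb i
    exact ⟨m + n, by push_cast; rw [← hm, ← hn]; rfl⟩
  zero_mem' := fun i => ⟨0, by simp⟩
  neg_mem' := by
    intro a ha i
    obtain ⟨m, hm⟩ := ha i
    exact ⟨-m, by push_cast; rw [← hm]; rfl⟩

/-- The torus `T² = ℝ²/ℤ²`, with the quotient (Euclidean) metric. -/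
abbrev T2 : Type := R2 ⧸ intLattice

/-- The covering projection `π : ℝ² → T²`. -/
def pr : R2 → T2 := QuotientAddGroup.mk

instance : MeasurableSpace T2 := borel T2
instance : BorelSpace T2 := ⟨rfl⟩

/-- A fundamental domain `[0,1)²` for the lattice action. -/
def fundDomain : Set R2 := {x : R2 | ∀ i, x i ∈ Set.Ico (0 : ℝ) 1}

/-- Lebesgue (Haar) probability measure on the torus `T²`. -/
def lebT2 : Measure T2 := Measure.map pr (volume.restrict fundDomain)

/-- `F : ℝ² → ℝ²` is a lift of `f : T² → T²` if `π ∘ F = f ∘ π` and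
`F (x + w) = F x + w` for every lattice vector `w ∈ ℤ²`. -/
structure IsLift (f : T2 ≃ₜ T2) (F : R2 ≃ₜ R2) : Prop where
  proj : ∀ x : R2, pr (F x) = f (pr x)
  equivariant : ∀ x : R2, ∀ w ∈ intLattice, F (x + w) = F x + w

/-- `Homeo₀(T²)`: homeomorphisms of the torus isotopic to the identity,
characterized as those admitting a lift commuting with integer translations. -/
def Homeo0 : Set (T2 ≃ₜ T2) := {f | ∃ F : R2 ≃ₜ R2, IsLift f F}

/-- `Homeo_{0,λ}(T²)`: elements of `Homeo₀(T²)` preserving Lebesgue measure. -/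
def Homeo0Leb : Set (T2 ≃ₜ T2) :=
  {f | f ∈ Homeo0 ∧ MeasurePreserving f lebT2 lebT2}

/-- The uniform `C⁰` distance `d_{C⁰}(f,g) = sup_x d(f(x), g(x))` on torus maps. -/
def dC0 (f g : T2 ≃ₜ T2) : ℝ := ⨆ x : T2, dist (f x) (g x)

/-- The uniform distance `sup_{x ∈ ℝ²} ‖F(x) − G(x)‖` between maps of the plane. -/
def supDist (F G : R2 → R2) : ℝ := ⨆ x : R2, dist (F x) (G x)

/-- The rotation set `ρ(F̃)` of a lift: all limits `(F̃^{n_k}(z_k) − z_k)/n_k`. -/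
def rotSet (F : R2 ≃ₜ R2) : Set R2 :=
  {v | ∃ (z : ℕ → R2) (n : ℕ → ℕ), Tendsto n atTop atTop ∧
    Tendsto (fun k => (n k : ℝ)⁻¹ • ((⇑F)^[n k] (z k) - z k)) atTop (𝓝 v)}

/-- The rotation set of `f`, with fixed lift `F`, is `δ`-upper-stable in `H`. -/
def UpperStable (H : Set (T2 ≃ₜ T2)) (F : R2 ≃ₜ R2) (δ : ℝ) : Prop :=
  ∀ g ∈ H, ∀ G : R2 ≃ₜ R2, IsLift g G → supDist (⇑F) (⇑G) < δ →
    rotSet G ⊆ rotSet F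

/-- The rotation set of `f`, with fixed lift `F`, is `δ`-stable in `H`. -/
def StableRS (H : Set (T2 ≃ₜ T2)) (F : R2 ≃ₜ R2) (δ : ℝ) : Prop :=
  ∀ g ∈ H, ∀ G : R2 ≃ₜ R2, IsLift g G → supDist (⇑F) (⇑G) < δ →
    rotSet G = rotSet F

/-- `f` has a stable rotation set in `H`. -/
def HasStableRotSet (H : Set (T2 ≃ₜ T2)) (f : T2 ≃ₜ T2) : Prop :=
  ∃ F : R2 ≃ₜ R2, IsLift f F ∧ ∃ δ > 0, StableRS H F δ

/-- `S` is open in `H` for the uniform `C⁰` topology. -/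
def OpenIn (H S : Set (T2 ≃ₜ T2)) : Prop :=
  ∀ f ∈ S ∩ H, ∃ δ > 0, ∀ g ∈ H, dC0 f g < δ → g ∈ S

/-- `S` is dense in `H` for the uniform `C⁰` topology. -/
def DenseIn (H S : Set (T2 ≃ₜ T2)) : Prop :=
  ∀ f ∈ H, ∀ ε > 0, ∃ g ∈ S ∩ H, dC0 f g < ε

/-- `(x_i)_{0 ≤ i ≤ n}` is a finite `ε`-pseudo-orbit of `F`. -/
def IsPseudoOrbitUpTo (F : R2 → R2) (ε : ℝ) (x : ℕ → R2) (n : ℕ) : Prop :=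
  ∀ i < n, dist (F (x i)) (x (i + 1)) < ε

/-- `(x_i)_{i ∈ ℕ}` is an infinite `ε`-pseudo-orbit of `F`. -/
def IsPseudoOrbit (F : R2 → R2) (ε : ℝ) (x : ℕ → R2) : Prop :=
  ∀ i : ℕ, dist (F (x i)) (x (i + 1)) < ε

/-- The `ε`-pseudo-rotation set `ρ_ε(F̃)`. -/
def pseudoRotSet (F : R2 → R2) (ε : ℝ) : Set R2 :=
  {v | ∃ (n : ℕ → ℕ) (x : ℕ → ℕ → R2), Tendsto n atTop atTop ∧
    (∀ k, IsPseudoOrbitUpTo F ε (x k) (n k)) ∧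
    Tendsto (fun k => (n k : ℝ)⁻¹ • (x k (n k) - x k 0)) atTop (𝓝 v)}

/-- The oscillation `osc(f) = sup_{x,y} ‖(F(x) − x) − (F(y) − y)‖` of a lift. -/
def osc (F : R2 → R2) : ℝ := ⨆ p : R2 × R2, ‖(F p.1 - p.1) - (F p.2 - p.2)‖

/-- `f` has the shadowing property. -/
def Shadowing (f : T2 ≃ₜ T2) : Prop :=
  ∀ ε > 0, ∃ δ > 0, ∀ x : ℕ → T2, (∀ i, dist (f (x i)) (x (i + 1)) < δ) →
    ∃ z : T2, ∀ i, dist ((⇑f)^[i] z) (x i) < ε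

/-- `v ∈ ℚ² ⊂ ℝ²`. -/
def IsRationalPoint (v : R2) : Prop := ∀ i, ∃ q : ℚ, v i = (q : ℝ)


lemma exists_log {E : Type*} [NormedAddCommGroup E] [NormedSpace ℝ E] (f : E → ℂ)
    (hf : Continuous f) (h0 : ∀ x, f x ≠ 0) :
    ∃ g : E → ℂ, Continuous g ∧ ∀ x, Complex.exp (g x) = f x := by
  rcases Complex.isCoveringMapOn_exp.existsUnique_continuousMap_lifts (A := E)
    ⟨f, hf⟩ (a₀ := 0) (Complex.exp_log (h0 0)) (fun x => h0 x) with ⟨g, ⟨-, hg⟩, -⟩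
  exact ⟨g, g.continuous, fun x => congrFun hg x⟩

lemma const_of_exp (h : ℝ → ℂ) {a b : ℝ} (hab : a ≤ b) (hc : ContinuousOn h (Icc a b)) (c : ℂ)
    (he : ∀ t ∈ Icc a b, Complex.exp (h t) = c) : h a = h b := by
  have key : ∀ t ∈ Icc a b, ∃ n : ℤ, h t = h a + n * (2 * Real.pi * Complex.I) := by
    intro t ht
    apply Complex.exp_eq_exp_iff_exists_int.1
    rw [he t ht, he a (left_mem_Icc.2 hab)]
  -- the imaginary part takes values in a discrete set
  have hpc : IsPreconnected (h '' Icc a b) := isPreconnected_Icc.image h hc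
  have hd : (h '' Icc a b) ⊆ range (fun n : ℤ => h a + n * (2 * Real.pi * Complex.I)) := by
    rintro _ ⟨t, ht, rfl⟩
    obtain ⟨n, hn⟩ := key t ht
    exact ⟨n, hn.symm⟩
  have hcount : (h '' Icc a b).Countable := (countable_range _).mono hd
  have hsub := hcount.isTotallyDisconnected _ Subset.rfl hpc
  exact hsub (mem_image_of_mem h (left_mem_Icc.2 hab)) (mem_image_of_mem h (right_mem_Icc.2 hab))

lemma arch_core (γ : ℝ → ℂ) (hγ : Continuous γ) (s₀ s₁ : ℝ) (hs : s₀ ≤ s₁) (l : ℝ → ℂ)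
    (hl : Continuous l) (hexp : ∀ s ∈ Icc s₀ s₁, Complex.exp (l s) = γ s)
    (hlo : ∀ s ∈ Icc s₀ s₁, (l s₀).im ≤ (l s).im)
    (hhi : ∀ s ∈ Icc s₀ s₁, (l s).im ≤ (l s₀).im + Real.pi)
    (hend : (l s₁).im = (l s₀).im + Real.pi)
    (hbig : ∀ s ∈ Icc s₀ s₁, 8 < ‖γ s‖) :
    ∃ s ∈ Icc s₀ s₁, ∃ t ∈ Icc s₀ s₁, ∃ m n : ℤ, (m ≠ 0 ∨ n ≠ 0) ∧
      γ s - γ t = (m : ℂ) + (n : ℂ) * Complex.I := by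
  by_contra hcon
  push Not at hcon
  have h0mem : s₀ ∈ Icc s₀ s₁ := left_mem_Icc.2 hs
  have h1mem : s₁ ∈ Icc s₀ s₁ := right_mem_Icc.2 hs
  set u : ℂ := Complex.exp ((l s₀).im * Complex.I) with hu
  have hu0 : u ≠ 0 := Complex.exp_ne_zero _
  have hunorm : ‖u‖ = 1 := by rw [hu]; exact Complex.norm_exp_ofReal_mul_I _
  set Γ : ℝ → ℂ := fun s => γ s / u with hΓ
  have hΓc : Continuous Γ := hγ.div_const u
  have hΓn : ∀ s ∈ Icc s₀ s₁, 8 < ‖Γ s‖ := by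
    intro s hs'
    simp only [hΓ, norm_div, hunorm, div_one]
    exact hbig s hs'
  have hΓexp : ∀ s ∈ Icc s₀ s₁, Γ s = Complex.exp (l s - (l s₀).im * Complex.I) := by
    intro s hs'
    rw [Complex.exp_sub, hexp s hs']
  have hΓim : ∀ s ∈ Icc s₀ s₁, 0 ≤ (Γ s).im := by
    intro s hs'
    rw [hΓexp s hs', Complex.exp_im]
    apply mul_nonneg (Real.exp_pos _).le
    apply Real.sin_nonneg_of_nonneg_of_le_pi
    · simp; linarith [hlo s hs']
    · simp; linarith [hhi s hs']
  obtain ⟨r₀, hr₀⟩ : ∃ r : ℝ, Γ s₀ = r ∧ 0 < r := by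
    refine ⟨Real.exp (l s₀).re, ?_, Real.exp_pos _⟩
    rw [hΓexp s₀ h0mem, Complex.ofReal_exp]
    congr 1
    apply Complex.ext <;> simp
  obtain ⟨hr₀, hr₀p⟩ := hr₀
  obtain ⟨r₁, hr₁, hr₁p⟩ : ∃ r : ℝ, Γ s₁ = -(r : ℂ) ∧ 0 < r := by
    refine ⟨Real.exp (l s₁).re, ?_, Real.exp_pos _⟩
    have : l s₁ - (l s₀).im * Complex.I = ((l s₁).re : ℂ) + Real.pi * Complex.I := by
      apply Complex.ext <;> simp [hend]
    rw [hΓexp s₁ h1mem, Complex.ofReal_exp, this, Complex.exp_add, Complex.exp_pi_mul_I]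
    ring
  have hr₀8 : 8 < r₀ := by
    have := hΓn s₀ h0mem
    rw [hr₀, Complex.norm_real, Real.norm_of_nonneg hr₀p.le] at this
    exact this
  have hr₁8 : 8 < r₁ := by
    have := hΓn s₁ h1mem
    rw [hr₁, norm_neg, Complex.norm_real, Real.norm_of_nonneg hr₁p.le] at this
    exact this
  -- lattice point
  set tg : ℂ := u * (r₀ - 4 * Complex.I) with htg
  set m : ℤ := round tg.re
  set n : ℤ := round tg.im
  set w : ℂ := (m : ℂ) + (n : ℂ) * Complex.I with hw
  have herr : ‖tg - w‖ ≤ 1 := by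
    have h1 : |(tg - w).re| ≤ 1 / 2 := by
      simp [hw]; simpa using abs_sub_round tg.re
    have h2 : |(tg - w).im| ≤ 1 / 2 := by
      simp [hw]; simpa using abs_sub_round tg.im
    calc ‖tg - w‖ ≤ |(tg - w).re| + |(tg - w).im| := Complex.norm_le_abs_re_add_abs_im _
      _ ≤ 1 := by linarith
  set ζ : ℂ := r₀ - w / u with hζ
  have hwζ : w = u * (r₀ - ζ) := by rw [hζ]; field_simp; ring
  have hζerr : ‖ζ - 4 * Complex.I‖ ≤ 1 := by
    have : ζ - 4 * Complex.I = (tg - w) / u := by rw [hζ, htg]; field_simp; ring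
    rw [this, norm_div, hunorm, div_one]; exact herr
  have hζim : 0 < ζ.im := by
    have := (Complex.abs_im_le_norm (ζ - 4 * Complex.I)).trans hζerr
    simp at this
    have := (abs_le.1 this).1
    linarith
  have hζn : ‖ζ‖ ≤ 5 := by
    have : ζ = (ζ - 4 * Complex.I) + 4 * Complex.I := by ring
    rw [this]
    refine (norm_add_le _ _).trans ?_
    have : ‖(4 : ℂ) * Complex.I‖ = 4 := by simp
    linarith
  have hmn : m ≠ 0 ∨ n ≠ 0 := by
    by_contra hh
    push Not at hh
    have : w = 0 := by rw [hw, hh.1, hh.2]; simp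
    have h2 : (r₀ : ℂ) = ζ := by rw [hζ, this]; simp
    rw [← h2] at hζim
    simp at hζim
  -- the two-parameter logarithm
  set cl : ℝ → ℝ := fun s => max s₀ (min s s₁) with hcl
  have hclc : Continuous cl := by fun_prop
  have hclmem : ∀ s, cl s ∈ Icc s₀ s₁ := fun s =>
    ⟨le_max_left _ _, max_le hs (min_le_right _ _)⟩
  have hcleq : ∀ s ∈ Icc s₀ s₁, cl s = s := by
    intro s hs'
    simp only [hcl]
    rw [min_eq_left hs'.2, max_eq_right hs'.1]
  obtain ⟨G, hGc, hG⟩ := exists_log (fun p : ℝ × ℝ => γ (cl p.1) - γ (cl p.2) - w)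
    (by fun_prop) (fun p h => hcon _ (hclmem p.1) _ (hclmem p.2) m n hmn (sub_eq_zero.1 h))
  have hG' : ∀ s ∈ Icc s₀ s₁, ∀ t ∈ Icc s₀ s₁, Complex.exp (G (s, t)) = γ s - γ t - w := by
    intro s hs' t ht'
    rw [hG (s, t)]
    simp only [hcleq s hs', hcleq t ht']
  have hγΓ : ∀ s, γ s = u * Γ s := by intro s; simp only [hΓ]; field_simp
  have hdiag : G (s₀, s₀) = G (s₁, s₁) := by
    apply const_of_exp (fun t => G (t, t)) hs (by fun_prop) (-w)
    intro t ht
    simp only [hG' t ht t ht]; ring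
  have hΓ0 : ∀ t ∈ Icc s₀ s₁, Γ t ≠ 0 := fun t ht h => by
    have := hΓn t ht
    rw [h] at this; simp at this; linarith
  have hslit : ∀ t ∈ Icc s₀ s₁, 1 - ζ / Γ t ∈ Complex.slitPlane := by
    intro t ht
    left
    have h1 : ‖ζ / Γ t‖ < 1 := by
      rw [norm_div, div_lt_one (by linarith [hΓn t ht])]
      linarith [hΓn t ht]
    have := (Complex.abs_re_le_norm (ζ / Γ t))
    have := (abs_le.1 this).2
    simp only [Complex.sub_re, Complex.one_re]
    linarith
  have hp1 : G (s₀, s₀) - l s₀ - Complex.log (1 - ζ / Γ s₀) =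
      G (s₀, s₁) - l s₁ - Complex.log (1 - ζ / Γ s₁) := by
    apply const_of_exp (fun t => G (s₀, t) - l t - Complex.log (1 - ζ / Γ t)) hs ?_ (-1)
    · intro t ht
      have h1 : 1 - ζ / Γ t ≠ 0 := Complex.slitPlane_ne_zero (hslit t ht)
      rw [Complex.exp_sub, Complex.exp_sub, hG' s₀ h0mem t ht, hexp t ht, Complex.exp_log h1,
        hγΓ, hγΓ, hr₀, hwζ]
      have := hΓ0 t ht
      rw [div_div, div_eq_iff (mul_ne_zero (mul_ne_zero hu0 this) h1)]
      field_simp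
      ring
    · apply ContinuousOn.sub (by fun_prop)
      apply ContinuousOn.clog _ hslit
      exact continuousOn_const.sub (continuousOn_const.div hΓc.continuousOn hΓ0)
  have hslit2 : ∀ t ∈ Icc s₀ s₁, Γ t + r₁ - r₀ + ζ ∈ Complex.slitPlane := by
    intro t ht
    right
    have := hΓim t ht
    simp
    linarith
  have hp2 : G (s₀, s₁) - Complex.log (Γ s₀ + r₁ - r₀ + ζ) =
      G (s₁, s₁) - Complex.log (Γ s₁ + r₁ - r₀ + ζ) := by
    apply const_of_exp (fun t => G (t, s₁) - Complex.log (Γ t + r₁ - r₀ + ζ)) hs ?_ u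
    · intro t ht
      have h1 := Complex.slitPlane_ne_zero (hslit2 t ht)
      rw [Complex.exp_sub, hG' t ht s₁ h1mem, Complex.exp_log h1, hγΓ, hγΓ, hr₁, hwζ,
        div_eq_iff h1]
      ring
    · apply ContinuousOn.sub (by fun_prop)
      exact ContinuousOn.clog (by fun_prop) hslit2
  have e1 : Complex.arg (1 - ζ / Γ s₀) = Complex.arg (r₀ - ζ) := by
    have : (r₀ : ℂ) - ζ = r₀ * (1 - ζ / Γ s₀) := by
      rw [hr₀]; have : (r₀ : ℂ) ≠ 0 := by exact_mod_cast hr₀p.ne'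
      field_simp
    rw [this, Complex.arg_real_mul _ hr₀p]
  have e2 : Complex.arg (1 - ζ / Γ s₁) = Complex.arg (r₁ + ζ) := by
    have : (r₁ : ℂ) + ζ = r₁ * (1 - ζ / Γ s₁) := by
      rw [hr₁]; have : (r₁ : ℂ) ≠ 0 := by exact_mod_cast hr₁p.ne'
      field_simp
      ring
    rw [this, Complex.arg_real_mul _ hr₁p]
  have e3 : Complex.arg (Γ s₁ + r₁ - r₀ + ζ) = Complex.arg (r₀ - ζ) + Real.pi := by
    have : Γ s₁ + r₁ - r₀ + ζ = -(r₀ - ζ) := by rw [hr₁]; ring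
    rw [this]
    apply Complex.arg_neg_eq_arg_add_pi_of_im_neg
    simpa using hζim
  have e4 : Γ s₀ + r₁ - r₀ + ζ = r₁ + ζ := by rw [hr₀]; ring
  have i1 := congrArg Complex.im hp1
  have i2 := congrArg Complex.im hp2
  have i3 := congrArg Complex.im hdiag
  simp only [Complex.sub_im, Complex.log_im, e1, e2, e3, e4] at i1 i2 i3
  have := Real.pi_pos
  linarith

/-- identification of the plane with the complex numbers -/
def toC (z : R2) : ℂ := ⟨z 0, z 1⟩

lemma toC_norm (z : R2) : ‖toC z‖ = ‖z‖ := by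
  rw [EuclideanSpace.norm_eq, Complex.norm_def, Complex.normSq_apply]
  simp [toC, Fin.sum_univ_two, sq]

lemma toC_continuous : Continuous toC := by
  have : toC = fun z : R2 => (z 0 : ℂ) + (z 1 : ℂ) * Complex.I := by
    funext z; apply Complex.ext <;> simp [toC]
  rw [this]
  fun_prop

lemma toC_sub (a b : R2) : toC (a - b) = toC a - toC b := by
  apply Complex.ext <;> simp [toC]

lemma toC_sum {ι : Type*} (s : Finset ι) (w : ι → ℝ) (f : ι → R2) :
    toC (∑ i ∈ s, w i • f i) = ∑ i ∈ s, (w i : ℂ) * toC (f i) := by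
  apply Complex.ext <;> simp [toC]

lemma toC_inj {a b : R2} (h : toC a = toC b) : a = b := by
  ext i
  fin_cases i
  · exact congrArg Complex.re h
  · exact congrArg Complex.im h

lemma abs_coord_le (z : R2) (i : Fin 2) : |z i| ≤ ‖z‖ := by
  simpa using PiLp.norm_apply_le z i

lemma norm_le_of_coord (z : R2) (a : ℝ) (h : ∀ i, |z i| ≤ a) : ‖z‖ ≤ 2 * a := by
  rw [← toC_norm]
  refine (Complex.norm_le_abs_re_add_abs_im _).trans ?_
  have h0 := h 0
  have h1 := h 1
  simp only [toC]
  linarith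

/-- integer vector -/
def iv (k : Fin 2 → ℤ) : R2 := WithLp.toLp 2 (fun i => (k i : ℝ))

@[simp] lemma iv_apply (k : Fin 2 → ℤ) (i : Fin 2) : iv k i = (k i : ℝ) := rfl

lemma iv_mem (k : Fin 2 → ℤ) : iv k ∈ intLattice := fun i => ⟨k i, rfl⟩

lemma mem_iff_iv (w : R2) : w ∈ intLattice ↔ ∃ k, w = iv k := by
  constructor
  · intro h
    choose k hk using h
    exact ⟨k, by ext i; simp [hk i]⟩
  · rintro ⟨k, rfl⟩; exact iv_mem k

lemma exists_arch (θ : ℝ → ℝ) (hθ : Continuous θ) (h : θ 0 + Real.pi ≤ θ 1) :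
    ∃ s₀ s₁, 0 ≤ s₀ ∧ s₀ ≤ s₁ ∧ s₁ ≤ 1 ∧ (∀ s ∈ Icc s₀ s₁, θ s₀ ≤ θ s) ∧
      (∀ s ∈ Icc s₀ s₁, θ s ≤ θ s₀ + Real.pi) ∧ θ s₁ = θ s₀ + Real.pi := by
  have hpi := Real.pi_pos
  have hA : IsCompact (Icc (0 : ℝ) 1 ∩ {s | θ 0 + Real.pi ≤ θ s}) :=
    isCompact_Icc.inter_right (isClosed_le continuous_const hθ)
  obtain ⟨s₁, ⟨⟨hs1a, hs1b⟩, hs1c⟩, hleast⟩ :=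
    hA.exists_isLeast ⟨1, ⟨⟨zero_le_one, le_rfl⟩, h⟩⟩
  have hlt : ∀ s, 0 ≤ s → s < s₁ → θ s < θ 0 + Real.pi := by
    intro s h0 h1
    by_contra hh
    push Not at hh
    have := hleast ⟨⟨h0, h1.le.trans hs1b⟩, hh⟩
    linarith
  have hs1eq : θ s₁ = θ 0 + Real.pi := by
    by_contra hne
    have hgt : θ 0 + Real.pi < θ s₁ := lt_of_le_of_ne hs1c (Ne.symm hne)
    obtain ⟨s, hs, hs'⟩ := intermediate_value_Icc hs1a hθ.continuousOn
      (show θ 0 + Real.pi ∈ Icc (θ 0) (θ s₁) from ⟨by linarith, hgt.le⟩)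
    rcases eq_or_lt_of_le hs.2 with h1 | h1
    · rw [h1] at hs'; linarith
    · have := hlt s hs.1 h1; linarith
  have hB : IsCompact (Icc (0 : ℝ) s₁ ∩ {s | θ s ≤ θ 0}) :=
    isCompact_Icc.inter_right (isClosed_le hθ continuous_const)
  obtain ⟨s₀, ⟨⟨hs0a, hs0b⟩, hs0c⟩, hgr⟩ :=
    hB.exists_isGreatest ⟨0, ⟨⟨le_rfl, hs1a⟩, le_refl (θ 0)⟩⟩
  have hgt : ∀ s, s₀ < s → s ≤ s₁ → θ 0 < θ s := by
    intro s h0 h1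
    by_contra hh
    push Not at hh
    have := hgr ⟨⟨hs0a.trans h0.le, h1⟩, hh⟩
    linarith
  have hs0eq : θ s₀ = θ 0 := by
    by_contra hne
    have hlt' : θ s₀ < θ 0 := lt_of_le_of_ne hs0c hne
    obtain ⟨s, hs, hs'⟩ := intermediate_value_Icc hs0b hθ.continuousOn
      (show θ 0 ∈ Icc (θ s₀) (θ s₁) from ⟨hlt'.le, by linarith⟩)
    rcases eq_or_lt_of_le hs.1 with h1 | h1
    · rw [← h1] at hs'; linarith
    · have := hgt s h1 hs.2; linarith
  refine ⟨s₀, s₁, hs0a, hs0b, hs1b, ?_, ?_, by rw [hs1eq, hs0eq]⟩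
  · intro s hs
    rcases eq_or_lt_of_le hs.1 with h1 | h1
    · rw [h1]
    · rw [hs0eq]; exact (hgt s h1 hs.2).le
  · intro s hs
    rw [hs0eq]
    rcases eq_or_lt_of_le hs.2 with h1 | h1
    · rw [h1, hs1eq]
    · exact (hlt s (hs0a.trans hs.1) h1).le

lemma half_plane {ι : Type*} [Fintype ι] (wt : ι → ℝ) (hw0 : ∀ i, 0 ≤ wt i)
    (hw1 : ∑ i, wt i = 1) (g : ι → ℂ)
    (hsum : ∑ i, (wt i : ℂ) * Complex.exp (g i) = 0) :
    ∃ j k, (g k).im + Real.pi ≤ (g j).im := by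
  by_contra hcon
  push Not at hcon
  have hne : Nonempty ι := by
    by_contra h
    rw [not_nonempty_iff] at h
    simp at hw1
  obtain ⟨j, hj⟩ := Finite.exists_max (fun i => (g i).im)
  obtain ⟨k, hk⟩ := Finite.exists_min (fun i => (g i).im)
  have hjk := hcon j k
  set μ := ((g j).im + (g k).im) / 2 with hμ
  have hpos : ∀ i, 0 < (Complex.exp (g i) * Complex.exp (-μ * Complex.I)).re := by
    intro i
    rw [← Complex.exp_add, Complex.exp_re]
    apply mul_pos (Real.exp_pos _)
    apply Real.cos_pos_of_mem_Ioo
    have h1 := hj i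
    have h2 := hk i
    simp only [Complex.add_im, Complex.mul_im, Complex.neg_re, Complex.ofReal_re, Complex.I_im,
      Complex.neg_im, Complex.ofReal_im, Complex.I_re]
    constructor <;> linarith
  have h0 : ∑ i, wt i * (Complex.exp (g i) * Complex.exp (-μ * Complex.I)).re = 0 := by
    have := congrArg (fun z => (z * Complex.exp (-μ * Complex.I)).re) hsum
    simp only [zero_mul, Complex.zero_re, Finset.sum_mul, Complex.re_sum] at this
    rw [← this]
    refine Finset.sum_congr rfl fun i _ => ?_
    rw [mul_assoc, Complex.re_ofReal_mul]
  have h1 : ∀ i ∈ Finset.univ, wt i * (Complex.exp (g i) * Complex.exp (-μ * Complex.I)).re = 0 :=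
    (Finset.sum_eq_zero_iff_of_nonneg (fun i _ => mul_nonneg (hw0 i) (hpos i).le)).1 h0
  have h2 : ∀ i, wt i = 0 := fun i => by
    rcases mul_eq_zero.1 (h1 i (Finset.mem_univ i)) with h | h
    · exact h
    · exact absurd h (hpos i).ne'
  simp [h2] at hw1

/-- clamp of the plane onto a square -/
def clampSq (κ : ℝ) (z : R2) : R2 := WithLp.toLp 2 (fun i => max 0 (min (z i) κ))

lemma topo_lemma (H : R2 → R2) (hc : Continuous H) (hinj : Function.Injective H)
    (heq : ∀ x, ∀ w ∈ intLattice, H (x + w) = H x + w) (c : R2)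
    (hcc : c ∈ convexHull ℝ (range fun z => H z - z)) :
    ∃ z, ‖H z - z - c‖ ≤ 10 := by
  by_contra hcon
  push Not at hcon
  obtain ⟨ι, _, wt, pt, hw0, hw1, hpt, hsum⟩ := mem_convexHull_iff_exists_fintype.1 hcc
  have hne : Nonempty ι := by
    by_contra h
    rw [not_nonempty_iff] at h
    simp at hw1
  have hz : ∀ i, ∃ z : R2, (∀ j, 0 ≤ z j ∧ z j < 1) ∧ H z - z = pt i := by
    intro i
    obtain ⟨y, hy⟩ := hpt i
    refine ⟨y + iv (fun j => -⌊y j⌋), fun j => ?_, ?_⟩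
    · have h1 := Int.floor_le (y j)
      have h2 := Int.lt_floor_add_one (y j)
      simp
      constructor <;> linarith
    · rw [heq _ _ (iv_mem _), ← hy]; simp
  choose z hz01 hzH using hz
  obtain ⟨⟨i₀, j₀⟩, hmax⟩ := Finite.exists_max (fun p : ι × Fin 2 => z p.1 p.2)
  set κ := z i₀ j₀ with hκ
  have hκ1 : κ < 1 := (hz01 i₀ j₀).2
  have hκ0 : 0 ≤ κ := (hz01 i₀ j₀).1
  have hzκ : ∀ i j, z i j ≤ κ := fun i j => hmax (i, j)
  set Q : Set R2 := {x | ∀ j, 0 ≤ x j ∧ x j ≤ κ} with hQ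
  have hzQ : ∀ i, z i ∈ Q := fun i j => ⟨(hz01 i j).1, hzκ i j⟩
  have hQconv : Convex ℝ Q := by
    intro x hx y hy a b ha hb hab j
    have := hx j
    have := hy j
    simp only [PiLp.add_apply, PiLp.smul_apply, smul_eq_mul]
    constructor
    · have := (hx j).1; have := (hy j).1; positivity
    · nlinarith [mul_le_mul_of_nonneg_left (hx j).2 ha, mul_le_mul_of_nonneg_left (hy j).2 hb]
  set zb : R2 := ∑ i, wt i • z i with hzb
  have hzbQ : zb ∈ Q := hQconv.sum_mem (fun i _ => hw0 i) hw1 (fun i _ => hzQ i)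
  set v : R2 := c + zb with hv
  have hvsum : ∑ i, wt i • (H (z i) - v) = 0 := by
    simp only [smul_sub, Finset.sum_sub_distrib, ← Finset.sum_smul, hw1, one_smul]
    rw [hv, ← hsum, hzb, ← Finset.sum_add_distrib, sub_eq_zero]
    refine Finset.sum_congr rfl fun i _ => ?_
    rw [← smul_add, ← hzH i]; simp
  have hfar : ∀ x ∈ Q, 8 < ‖toC (H x - v)‖ := by
    intro x hx
    rw [toC_norm]
    have h1 := hcon x
    have h2 : ‖x - zb‖ ≤ 2 * 1 := by
      apply norm_le_of_coord
      intro j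
      have := hx j
      have := hzbQ j
      simp only [PiLp.sub_apply]
      rw [abs_le]; constructor <;> linarith
    have h3 : H x - x - c = (H x - v) - (x - zb) := by rw [hv]; abel
    rw [h3] at h1
    have := norm_sub_le (H x - v) (x - zb)
    linarith
  have hclQ : ∀ x, clampSq κ x ∈ Q := fun x j =>
    ⟨le_max_left _ _, max_le hκ0 (min_le_right _ _)⟩
  have hclc : Continuous (clampSq κ) := by
    unfold clampSq
    refine (PiLp.continuous_toLp 2 _).comp ?_
    fun_prop
  have hcleq : ∀ x ∈ Q, clampSq κ x = x := by
    intro x hx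
    ext j
    simp only [clampSq]
    rw [min_eq_left (hx j).2, max_eq_right (hx j).1]
  obtain ⟨g, hgc, hg⟩ := exists_log (fun x : R2 => toC (H (clampSq κ x) - v))
    (toC_continuous.comp ((hc.comp hclc).sub continuous_const)) (fun x h => by
      have := hfar _ (hclQ x)
      rw [h] at this; simp at this; linarith)
  have hg' : ∀ x ∈ Q, Complex.exp (g x) = toC (H x - v) := by
    intro x hx
    rw [hg x]; simp only [hcleq x hx]
  obtain ⟨j, k, hjk⟩ := half_plane wt hw0 hw1 (fun i => g (z i)) (by
    have := congrArg toC hvsum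
    rw [toC_sum] at this
    simp only [hg' _ (hzQ _)]
    rw [this]; apply Complex.ext <;> simp [toC])
  set p : ℝ → R2 := fun s => z k + s • (z j - z k) with hp
  have hpc : Continuous p := by fun_prop
  have hpQ : ∀ s, 0 ≤ s → s ≤ 1 → p s ∈ Q := by
    intro s h0 h1
    have := hQconv (hzQ k) (hzQ j) (sub_nonneg.2 h1) h0 (by ring)
    have e : p s = (1 - s) • z k + s • z j := by simp only [hp]; module
    rw [e]; exact this
  obtain ⟨s₀, s₁, h0, h01, h1, hlo, hhi, hend⟩ := exists_arch (fun s => (g (p s)).im)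
    (by fun_prop) (by simpa [hp] using hjk)
  have hpQ' : ∀ s ∈ Icc s₀ s₁, p s ∈ Q := fun s hs => hpQ s (h0.trans hs.1) (hs.2.trans h1)
  obtain ⟨s, hs, t, ht, m, n, hmn, hst⟩ := arch_core (fun s => toC (H (p s) - v))
    (toC_continuous.comp ((hc.comp hpc).sub continuous_const)) s₀ s₁ h01 (fun s => g (p s))
    (by fun_prop) (fun s hs => hg' _ (hpQ' s hs)) hlo hhi hend (fun s hs => hfar _ (hpQ' s hs))
  have hH : H (p s) = H (p t + iv ![m, n]) := by
    rw [heq _ _ (iv_mem _)]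
    apply toC_inj
    simp only [toC_sub] at hst
    have : toC (H (p t) + iv ![m, n]) = toC (H (p t)) + ((m : ℂ) + (n : ℂ) * Complex.I) := by
      apply Complex.ext <;> simp [toC]
    rw [this, ← hst]; ring
  have hpp := hinj hH
  have key : ∀ i, (![m, n] i) = 0 := by
    intro i
    have e : p s i = p t i + (![m, n] i : ℤ) := by
      rw [hpp]; simp
    have a1 := hpQ' s hs i
    have a2 := hpQ' t ht i
    have b1 : ((![m, n] i : ℤ) : ℝ) < 1 := by linarith
    have b2 : (-1 : ℝ) < ((![m, n] i : ℤ) : ℝ) := by linarith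
    have c1 : (![m, n] i : ℤ) < 1 := by exact_mod_cast b1
    have c2 : -1 < (![m, n] i : ℤ) := by exact_mod_cast b2
    omega
  have k0 := key 0
  have k1 := key 1
  simp at k0 k1
  rcases hmn with h | h
  · exact h k0
  · exact h k1

/-- commuting with integer translations -/
def Equi (F : R2 → R2) : Prop := ∀ x, ∀ w ∈ intLattice, F (x + w) = F x + w

lemma Equi.comp {F G : R2 → R2} (hF : Equi F) (hG : Equi G) : Equi (F ∘ G) := by
  intro x w hw
  simp only [Function.comp_apply]
  rw [hG x w hw, hF _ w hw]

lemma Equi.iterate {F : R2 → R2} (hF : Equi F) (n : ℕ) : Equi (F^[n]) := by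
  induction n with
  | zero => intro x w _; rfl
  | succ n ih => rw [Function.iterate_succ]; exact ih.comp hF

lemma Equi.bounded {F : R2 → R2} (hF : Equi F) (hc : Continuous F) :
    ∃ B, 0 < B ∧ ∀ z, ‖F z - z‖ ≤ B := by
  have hK : IsCompact (closedBall (0 : R2) 2) := isCompact_closedBall _ _
  obtain ⟨B, hB⟩ := hK.exists_bound_of_continuousOn
    (f := fun z => F z - z) (hc.sub continuous_id).continuousOn
  refine ⟨max B 1, by positivity, fun z => ?_⟩
  have h1 : z + iv (fun j => -⌊z j⌋) ∈ closedBall (0 : R2) 2 := by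
    rw [mem_closedBall_zero_iff]
    have := norm_le_of_coord (z + iv (fun j => -⌊z j⌋)) 1 (fun j => by
      have h1 := Int.floor_le (z j)
      have h2 := Int.lt_floor_add_one (z j)
      simp only [PiLp.add_apply, iv_apply, Int.cast_neg]
      rw [abs_le]; constructor <;> linarith)
    linarith
  have h2 := hB _ h1
  rw [hF _ _ (iv_mem _)] at h2
  simp only [add_sub_add_right_eq_sub] at h2
  exact h2.trans (le_max_left _ _)

lemma iterate_bound {F : R2 → R2} {B : ℝ} (hB : ∀ z, ‖F z - z‖ ≤ B) (n : ℕ) (z : R2) :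
    ‖F^[n] z - z‖ ≤ n * B := by
  induction n with
  | zero => simp
  | succ n ih =>
    rw [Function.iterate_succ_apply']
    have : F (F^[n] z) - z = (F (F^[n] z) - F^[n] z) + (F^[n] z - z) := by abel
    rw [this]
    refine (norm_add_le _ _).trans ?_
    push_cast
    linarith [hB (F^[n] z)]

lemma block_mem {F : R2 → R2} (n m : ℕ) (hm : 0 < m) (z : R2) :
    (m : ℝ)⁻¹ • (F^[n * m] z - z) ∈ convexHull ℝ (range fun z => F^[n] z - z) := by
  have h1 : ∀ m : ℕ, F^[n * m] z - z =
      ∑ j ∈ Finset.range m, (F^[n] (F^[n * j] z) - F^[n * j] z) := by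
    intro m
    induction m with
    | zero => simp
    | succ m ih =>
      rw [Finset.sum_range_succ, ← ih, ← Function.iterate_add_apply, Nat.mul_succ, Nat.add_comm]
      abel
  rw [h1, Finset.smul_sum]
  apply (convex_convexHull ℝ _).sum_mem
  · intro i _; positivity
  · have : (m : ℝ) ≠ 0 := by exact_mod_cast hm.ne'
    simp [this]
  · intro i _
    apply subset_convexHull
    exact ⟨_, rfl⟩

lemma rot_approx (F : R2 ≃ₜ R2) (hF : Equi F) (a : R2) (ha : a ∈ rotSet F) (n : ℕ) :
    ∃ c ∈ convexHull ℝ (range fun z => (⇑F)^[n] z - z), ‖c - (n : ℝ) • a‖ ≤ 1 := by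
  rcases Nat.eq_zero_or_pos n with rfl | hn
  · refine ⟨0, subset_convexHull ℝ _ ⟨0, by simp⟩, by simp⟩
  obtain ⟨B, hB0, hB⟩ := hF.bounded F.continuous
  obtain ⟨z, N, hN, hlim⟩ := ha
  have hnR : (0 : ℝ) < n := by exact_mod_cast hn
  obtain ⟨M₀, hM₀⟩ := exists_nat_gt (4 * n * B)
  have e1 := (Metric.tendsto_nhds.1 hlim) (1 / (2 * n)) (by positivity)
  have e2 := hN.eventually_ge_atTop (n * (M₀ + 1))
  obtain ⟨k, hk1, hk2⟩ := (e1.and e2).exists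
  set m := N k / n with hm
  set r := N k % n with hr
  have hNk : N k = n * m + r := (Nat.div_add_mod _ _).symm
  have hrn : r < n := Nat.mod_lt _ hn
  have hmM : M₀ + 1 ≤ m := by
    rw [hm, Nat.le_div_iff_mul_le hn]; linarith
  have hm0 : 0 < m := by omega
  have hmR : (0 : ℝ) < m := by exact_mod_cast hm0
  have hmR' : 4 * n * B < m := by
    have : ((M₀ + 1 : ℕ) : ℝ) ≤ m := by exact_mod_cast hmM
    push_cast at this; linarith
  refine ⟨_, block_mem n m hm0 (z k), ?_⟩
  set c := (m : ℝ)⁻¹ • ((⇑F)^[n * m] (z k) - z k) with hc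
  set x := (N k : ℝ)⁻¹ • ((⇑F)^[N k] (z k) - z k) with hx
  have hN0 : 0 < N k := by
    rw [hNk]; positivity
  have hNR : (0 : ℝ) < N k := by exact_mod_cast hN0
  have hxB : ‖x‖ ≤ B := by
    rw [hx, norm_smul, norm_inv, Real.norm_of_nonneg hNR.le, inv_mul_le_iff₀ hNR]
    exact iterate_bound hB _ _
  set R := (⇑F)^[r] ((⇑F)^[n * m] (z k)) - (⇑F)^[n * m] (z k) with hR
  have hRB : ‖R‖ ≤ n * B := by
    refine (iterate_bound hB _ _).trans ?_
    have : (r : ℝ) ≤ n := by exact_mod_cast hrn.le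
    gcongr
  have hNx : (N k : ℝ) • x = (m : ℝ) • c + R := by
    rw [hx, hc, smul_inv_smul₀ hNR.ne', smul_inv_smul₀ hmR.ne', hR, ← Function.iterate_add_apply,
      hNk, Nat.add_comm r]
    abel
  have hcx : (m : ℝ) • (c - (n : ℝ) • x) = (r : ℝ) • x - R := by
    have : (m : ℝ) • c = (N k : ℝ) • x - R := by rw [hNx]; abel
    rw [smul_sub, this, hNk]
    push_cast
    module
  have h1 : (m : ℝ) * ‖c - (n : ℝ) • x‖ ≤ 2 * n * B := by
    have e := congrArg norm hcx
    rw [norm_smul, Real.norm_of_nonneg hmR.le] at e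
    rw [e]
    refine (norm_sub_le _ _).trans ?_
    rw [norm_smul, Real.norm_of_nonneg (by positivity)]
    have h3 : (r : ℝ) ≤ n := by exact_mod_cast hrn.le
    have : (r : ℝ) * ‖x‖ ≤ n * B := by gcongr
    linarith
  have h2 : ‖c - (n : ℝ) • x‖ ≤ 1 / 2 := by
    by_contra hh
    push Not at hh
    nlinarith
  have h3 : ‖(n : ℝ) • x - (n : ℝ) • a‖ ≤ 1 / 2 := by
    rw [← smul_sub, norm_smul, Real.norm_of_nonneg hnR.le, ← dist_eq_norm]
    have := hk1.le
    calc (n : ℝ) * dist x a ≤ n * (1 / (2 * n)) := by gcongr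
      _ = 1 / 2 := by field_simp
  have : c - (n : ℝ) • a = (c - (n : ℝ) • x) + ((n : ℝ) • x - (n : ℝ) • a) := by abel
  rw [this]
  refine (norm_add_le _ _).trans ?_
  linarith

lemma rot_convex (F : R2 ≃ₜ R2) (hF : Equi F) : Convex ℝ (rotSet F) := by
  intro a ha b hb α β hα hβ hαβ
  have key : ∀ n : ℕ, ∃ z, ‖(⇑F)^[n] z - z - (n : ℝ) • (α • a + β • b)‖ ≤ 11 := by
    intro n
    obtain ⟨c, hc, hca⟩ := rot_approx F hF a ha n
    obtain ⟨d, hd, hdb⟩ := rot_approx F hF b hb n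
    obtain ⟨z, hz⟩ := topo_lemma ((⇑F)^[n]) (F.continuous.iterate n) (F.injective.iterate n)
      (hF.iterate n) _ (convex_convexHull ℝ _ hc hd hα hβ hαβ)
    refine ⟨z, ?_⟩
    have e : (⇑F)^[n] z - z - (n : ℝ) • (α • a + β • b) =
      ((⇑F)^[n] z - z - (α • c + β • d)) + (α • (c - (n : ℝ) • a) + β • (d - (n : ℝ) • b)) := by
      module
    rw [e]
    refine (norm_add_le _ _).trans ?_
    have h1 : ‖α • (c - (n : ℝ) • a) + β • (d - (n : ℝ) • b)‖ ≤ 1 := by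
      refine (norm_add_le _ _).trans ?_
      rw [norm_smul, norm_smul, Real.norm_of_nonneg hα, Real.norm_of_nonneg hβ]
      nlinarith
    linarith
  choose z hz using key
  refine ⟨z, id, tendsto_id, ?_⟩
  rw [tendsto_iff_norm_sub_tendsto_zero]
  have hlim : Tendsto (fun n : ℕ => 11 * (n : ℝ)⁻¹) atTop (𝓝 0) := by
    simpa using (tendsto_inv_atTop_nhds_zero_nat (𝕜 := ℝ)).const_mul 11
  refine squeeze_zero' (Eventually.of_forall fun _ => norm_nonneg _) ?_ hlim
  filter_upwards [eventually_gt_atTop 0] with n hn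
  have hnR : (0 : ℝ) < n := by exact_mod_cast hn
  have : ((n : ℝ)⁻¹ • ((⇑F)^[n] (z n) - z n) - (α • a + β • b)) =
      (n : ℝ)⁻¹ • ((⇑F)^[n] (z n) - z n - (n : ℝ) • (α • a + β • b)) := by
    rw [smul_sub _ _ ((n : ℝ) • (α • a + β • b)), inv_smul_smul₀ hnR.ne']
  simp only [id]
  rw [this, norm_smul, norm_inv, Real.norm_of_nonneg hnR.le, mul_comm]
  gcongr
  exact hz n


lemma Equi.symm {G : R2 ≃ₜ R2} (hG : Equi G) : Equi G.symm := by
  intro x w hw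
  apply G.injective
  rw [hG _ w hw]
  simp

lemma Equi.sub_lat {F : R2 → R2} (hF : Equi F) (x w : R2) (hw : w ∈ intLattice) :
    F (x - w) = F x - w := by
  rw [sub_eq_add_neg, hF x _ (neg_mem hw), sub_eq_add_neg]

/-- the torus map induced by an equivariant map -/
def torMap (G : R2 → R2) (hG : Equi G) : T2 → T2 :=
  Quotient.lift (fun x => pr (G x)) (by
    intro a b hab
    have h : -a + b ∈ intLattice := QuotientAddGroup.leftRel_apply.1 hab
    have e : G b = G a + (-a + b) := by
      rw [← hG a _ h]; congr 1; abel
    change pr (G a) = pr (G b)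
    rw [pr, QuotientAddGroup.eq, e]
    simpa using h)

lemma torMap_pr (G : R2 → R2) (hG : Equi G) (x : R2) : torMap G hG (pr x) = pr (G x) := rfl

lemma pr_surj : Function.Surjective pr := QuotientAddGroup.mk_surjective

lemma torMap_cont (G : R2 → R2) (hG : Equi G) (hc : Continuous G) : Continuous (torMap G hG) := by
  apply Continuous.quotient_lift
  exact continuous_quotient_mk'.comp hc

lemma exists_tor (G : R2 ≃ₜ R2) (hG : Equi G) : ∃ g : T2 ≃ₜ T2, IsLift g G := by
  have hs : Equi G.symm := Equi.symm hG
  have h1 : Function.LeftInverse (torMap G.symm hs) (torMap G hG) := ?_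
  have h2 : Function.RightInverse (torMap G.symm hs) (torMap G hG) := ?_
  · exact ⟨⟨⟨torMap G hG, torMap G.symm hs, h1, h2⟩, torMap_cont _ hG G.continuous,
      torMap_cont _ hs G.symm.continuous⟩, ⟨fun x => rfl, hG⟩⟩
  · intro x
    obtain ⟨y, rfl⟩ := pr_surj x
    rw [torMap_pr, torMap_pr]; simp
  · intro x
    obtain ⟨y, rfl⟩ := pr_surj x
    rw [torMap_pr, torMap_pr]; simp

lemma supDist_le (F G : R2 → R2) (d : ℝ) (h : ∀ z, ‖G z - F z‖ ≤ d) : supDist F G ≤ d := by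
  apply ciSup_le
  intro x
  rw [dist_comm, dist_eq_norm]
  exact h x

lemma iterate_lat {F : R2 → R2} (hF : Equi F) {m : ℕ} {x w : R2} (hw : w ∈ intLattice)
    (h : F^[m] x = x + w) (k : ℕ) : F^[k * m] x = x + (k : ℝ) • w := by
  induction k with
  | zero => simp
  | succ k ih =>
    rw [Nat.succ_mul, Nat.add_comm, Function.iterate_add_apply, ih]
    have : (k : ℝ) • w ∈ intLattice := by
      rw [Nat.cast_smul_eq_nsmul]; exact nsmul_mem hw k
    rw [hF.iterate m _ _ this, h]
    push_cast
    module

lemma per_rot (G : R2 ≃ₜ R2) (hG : Equi G) {m : ℕ} (hm : 0 < m) {x w : R2}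
    (hw : w ∈ intLattice) (h : (⇑G)^[m] x = x + w) : (m : ℝ)⁻¹ • w ∈ rotSet G := by
  refine ⟨fun _ => x, fun k => (k + 1) * m, ?_, ?_⟩
  · apply tendsto_atTop_mono (f := fun k => k)
    · intro k; nlinarith
    · exact tendsto_id
  · have : (fun k : ℕ => (((k + 1) * m : ℕ) : ℝ)⁻¹ • ((⇑G)^[(k + 1) * m] x - x)) =
      fun _ => (m : ℝ)⁻¹ • w := by
      funext k
      rw [iterate_lat hG hw h]
      have h1 : (m : ℝ) ≠ 0 := by exact_mod_cast hm.ne'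
      have h2 : ((k : ℝ) + 1) ≠ 0 := by positivity
      rw [add_sub_cancel_left, smul_smul]
      congr 1
      push_cast
      field_simp
    rw [this]
    exact tendsto_const_nhds

lemma push (a u : R2) (r : ℝ) (hr : ‖u‖ < r) : ∃ h : R2 ≃ₜ R2, Equi h ∧ h a = a + u ∧
    (∀ z, ‖h z - z‖ ≤ ‖u‖) ∧ ∀ z, (∀ w ∈ intLattice, r ≤ dist z (a + w)) → h z = z := by
  have hr0 : 0 < r := (norm_nonneg u).trans_lt hr
  set A : Set R2 := (fun w => a + w) '' (intLattice : Set R2) with hA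
  have hAne : A.Nonempty := ⟨a + 0, 0, zero_mem _, rfl⟩
  set φ : R2 → ℝ := fun z => max 0 (1 - infDist z A / r) with hφ
  have hφ0 : ∀ z, 0 ≤ φ z := fun z => le_max_left _ _
  have hφ1 : ∀ z, φ z ≤ 1 := fun z => by
    apply max_le zero_le_one
    have : 0 ≤ infDist z A / r := div_nonneg infDist_nonneg hr0.le
    linarith
  have hlip : ∀ x y, |φ x - φ y| ≤ ‖x - y‖ / r := by
    intro x y
    have h1 : |φ x - φ y| ≤ |(1 - infDist x A / r) - (1 - infDist y A / r)| := by
      simp only [hφ]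
      have := abs_max_sub_max_le_abs (1 - infDist x A / r) (1 - infDist y A / r) 0
      rwa [max_comm _ (0:ℝ), max_comm _ (0:ℝ)] at this
    refine h1.trans ?_
    have h2 := (lipschitz_infDist_pt A).dist_le_mul x y
    rw [Real.dist_eq, dist_eq_norm] at h2
    simp only [NNReal.coe_one, one_mul] at h2
    have h3 : (1 - infDist x A / r) - (1 - infDist y A / r) = -(infDist x A - infDist y A) / r := by
      ring
    rw [h3, abs_div, abs_neg, abs_of_pos hr0]
    gcongr
  have hper : ∀ x, ∀ w ∈ intLattice, φ (x + w) = φ x := by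
    intro x w hw
    have h1 : (fun z => z + w) '' A = A := by
      ext z
      constructor
      · rintro ⟨_, ⟨t, ht, rfl⟩, rfl⟩
        exact ⟨t + w, add_mem ht hw, by simp only; abel⟩
      · rintro ⟨t, ht, rfl⟩
        exact ⟨a + (t - w), ⟨t - w, sub_mem ht hw, rfl⟩, by simp only; abel⟩
    have h2 := infDist_image (t := A) (x := x) (Φ := fun z : R2 => z + w) (isometry_add_right w)
    rw [h1] at h2
    simp only [hφ]
    rw [h2]
  have happ : ApproximatesLinearOn (fun z => z + φ z • u)
      ((ContinuousLinearEquiv.refl ℝ R2 : R2 ≃L[ℝ] R2) : R2 →L[ℝ] R2) univ (‖u‖₊ / r.toNNReal) := by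
    rw [ApproximatesLinearOn]
    intro x _ y _
    have e : x + φ x • u - (y + φ y • u) -
        ((ContinuousLinearEquiv.refl ℝ R2 : R2 ≃L[ℝ] R2) : R2 →L[ℝ] R2) (x - y)
        = (φ x - φ y) • u := by
      simp only [ContinuousLinearEquiv.coe_refl, ContinuousLinearMap.coe_id', id_eq]
      module
    rw [e, norm_smul, Real.norm_eq_abs]
    have := hlip x y
    calc |φ x - φ y| * ‖u‖ ≤ ‖x - y‖ / r * ‖u‖ := by gcongr
      _ = _ := by
        rw [NNReal.coe_div, coe_nnnorm, Real.coe_toNNReal _ hr0.le]; ring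
  have hc : Subsingleton R2 ∨ ‖u‖₊ / r.toNNReal <
      ‖((ContinuousLinearEquiv.refl ℝ R2).symm : R2 →L[ℝ] R2)‖₊⁻¹ := by
    right
    have : ‖((ContinuousLinearEquiv.refl ℝ R2).symm : R2 →L[ℝ] R2)‖₊ = 1 := by
      ext
      simp
    rw [this, inv_one, div_lt_one (by simpa using hr0)]
    rw [← NNReal.coe_lt_coe, coe_nnnorm, Real.coe_toNNReal _ hr0.le]
    exact hr
  refine ⟨happ.toHomeomorph _ hc, ?_, ?_, ?_, ?_⟩
  · intro x w hw
    change (x + w) + φ (x + w) • u = x + φ x • u + w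
    rw [hper x w hw]; abel
  · change a + φ a • u = a + u
    have : infDist a A = 0 := infDist_zero_of_mem ⟨0, zero_mem _, by simp⟩
    simp [hφ, this]
  · intro z
    change ‖z + φ z • u - z‖ ≤ ‖u‖
    rw [add_sub_cancel_left, norm_smul, Real.norm_of_nonneg (hφ0 z)]
    exact mul_le_of_le_one_left (norm_nonneg _) (hφ1 z)
  · intro z hz
    change z + φ z • u = z
    have : r ≤ infDist z A := by
      rw [le_infDist hAne]
      rintro _ ⟨w, hw, rfl⟩
      exact hz w hw
    have h1 : 1 ≤ infDist z A / r := by rwa [le_div_iff₀ hr0, one_mul]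
    have : φ z = 0 := by
      simp only [hφ]; exact max_eq_left (by linarith)
    simp [this]

lemma seg_move (a b : R2) (C : Set R2) (hC : IsClosed C)
    (hper : ∀ z ∈ C, ∀ w ∈ intLattice, z + w ∈ C) (hd : Disjoint (segment ℝ a b) C) :
    ∃ h : R2 ≃ₜ R2, Equi h ∧ h a = b ∧ (∀ z ∈ C, h z = z) ∧ ∀ z, ‖h z - z‖ ≤ ‖b - a‖ := by
  have hcomp : IsCompact (segment ℝ a b) := by
    rw [segment_eq_image']
    exact isCompact_Icc.image (by fun_prop)
  obtain ⟨r, hr0, hr⟩ := hd.exists_thickenings hcomp hC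
  have hfar : ∀ c ∈ segment ℝ a b, ∀ z ∈ C, r ≤ dist z c := by
    intro c hc z hz
    by_contra hlt
    push Not at hlt
    refine Set.disjoint_left.1 hr (?_ : z ∈ _) (self_subset_thickening hr0 _ hz)
    rw [mem_thickening_iff]
    exact ⟨c, hc, hlt⟩
  obtain ⟨k, hk⟩ := exists_nat_gt (‖b - a‖ / r)
  have hk0 : (0 : ℝ) < k := lt_of_le_of_lt (by positivity) hk
  set u : R2 := (k : ℝ)⁻¹ • (b - a) with hu
  have hun : ‖u‖ = ‖b - a‖ / k := by
    rw [hu, norm_smul, norm_inv, Real.norm_of_nonneg hk0.le]; ring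
  have hur : ‖u‖ < r := by
    rw [hun, div_lt_iff₀ hk0]
    rw [div_lt_iff₀ hr0] at hk
    linarith
  have key : ∀ j : ℕ, j ≤ k → ∃ h : R2 ≃ₜ R2, Equi h ∧ h a = a + (j : ℝ) • u ∧
      (∀ z ∈ C, h z = z) ∧ ∀ z, ‖h z - z‖ ≤ j * ‖u‖ := by
    intro j
    induction j with
    | zero =>
      intro _
      exact ⟨Homeomorph.refl _, fun _ _ _ => rfl, by simp, fun _ _ => rfl, by simp⟩
    | succ j ih =>
      intro hj
      obtain ⟨h, h1, h2, h3, h4⟩ := ih (by omega)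
      obtain ⟨g, g1, g2, g3, g4⟩ := push (a + (j : ℝ) • u) u r hur
      have hmem : a + (j : ℝ) • u ∈ segment ℝ a b := by
        rw [segment_eq_image']
        refine ⟨j / k, ⟨by positivity, ?_⟩, ?_⟩
        · rw [div_le_one hk0]; exact_mod_cast (by omega : j ≤ k)
        · simp only [hu, smul_smul]; rfl
      refine ⟨h.trans g, ?_, ?_, ?_, ?_⟩
      · exact Equi.comp (F := g) (G := h) g1 h1
      · simp only [Homeomorph.trans_apply, h2, g2]; push_cast; module
      · intro z hz
        simp only [Homeomorph.trans_apply, h3 z hz]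
        apply g4
        intro w hw
        have := hfar _ hmem _ (hper z hz _ (neg_mem hw))
        rw [dist_eq_norm] at this ⊢
        convert this using 2
        abel
      · intro z
        simp only [Homeomorph.trans_apply]
        have : g (h z) - z = (g (h z) - h z) + (h z - z) := by abel
        rw [this]
        refine (norm_add_le _ _).trans ?_
        push_cast
        linarith [g3 (h z), h4 z]
  obtain ⟨h, h1, h2, h3, h4⟩ := key k le_rfl
  refine ⟨h, h1, ?_, h3, ?_⟩
  · rw [h2, hu, smul_inv_smul₀ hk0.ne']; abel
  · intro z
    refine (h4 z).trans (le_of_eq ?_)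
    rw [hun]; field_simp

lemma multi_move {ι : Type*} (s : Finset ι) (a b : ι → R2) (U : ι → Set R2) (d : ℝ) (hd0 : 0 ≤ d)
    (hU : ∀ i ∈ s, IsOpen (U i))
    (hper : ∀ i ∈ s, ∀ z ∈ U i, ∀ w ∈ intLattice, z + w ∈ U i)
    (hdis : ∀ i ∈ s, ∀ j ∈ s, i ≠ j → Disjoint (U i) (U j))
    (hseg : ∀ i ∈ s, segment ℝ (a i) (b i) ⊆ U i) (hd : ∀ i ∈ s, ‖b i - a i‖ ≤ d) :
    ∃ h : R2 ≃ₜ R2, Equi h ∧ (∀ i ∈ s, h (a i) = b i) ∧ (∀ z, ‖h z - z‖ ≤ d) ∧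
      (∀ z, (∀ i ∈ s, z ∉ U i) → h z = z) := by
  classical
  induction s using Finset.induction_on with
  | empty =>
    exact ⟨Homeomorph.refl _, fun _ _ _ => rfl, by simp, by simpa using hd0, fun _ _ => rfl⟩
  | insert i s his ih =>
    obtain ⟨h, h1, h2, h3, h4⟩ := ih (fun j hj => hU j (Finset.mem_insert_of_mem hj))
      (fun j hj => hper j (Finset.mem_insert_of_mem hj))
      (fun j hj k hk => hdis j (Finset.mem_insert_of_mem hj) k (Finset.mem_insert_of_mem hk))
      (fun j hj => hseg j (Finset.mem_insert_of_mem hj))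
      (fun j hj => hd j (Finset.mem_insert_of_mem hj))
    have hi := Finset.mem_insert_self i s
    have hne : ∀ j ∈ s, i ≠ j := fun j hj e => his (e ▸ hj)
    obtain ⟨g, g1, g2, g3, g4⟩ := seg_move (a i) (b i) (U i)ᶜ (hU i hi).isClosed_compl
      (by
        intro z hz w hw hzw
        apply hz
        have := hper i hi _ hzw _ (neg_mem hw)
        simpa using this)
      (by
        rw [Set.disjoint_compl_right_iff_subset]; exact hseg i hi)
    -- apply `g` first
    have hgU : ∀ z, z ∈ U i → g z ∈ U i := by
      intro z hz
      by_contra hn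
      have : g (g z) = g z := g3 _ hn
      have := g.injective this
      rw [this] at hn
      exact hn hz
    have hfix : ∀ z ∈ U i, h z = z := by
      intro z hz
      apply h4
      intro j hj hzj
      exact Set.disjoint_left.1 (hdis i hi j (Finset.mem_insert_of_mem hj) (hne j hj)) hz hzj
    refine ⟨g.trans h, Equi.comp (F := h) (G := g) h1 g1, ?_, ?_, ?_⟩
    · intro j hj
      simp only [Homeomorph.trans_apply]
      rw [Finset.mem_insert] at hj
      rcases hj with rfl | hj
      · rw [g2]
        exact hfix _ (hseg j hi (right_mem_segment _ _ _))
      · rw [g3, h2 j hj]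
        intro hc
        exact Set.disjoint_left.1 (hdis i hi j (Finset.mem_insert_of_mem hj) (hne j hj)) hc
          (hseg j (Finset.mem_insert_of_mem hj) (left_mem_segment _ _ _))
    · intro z
      simp only [Homeomorph.trans_apply]
      by_cases hz : z ∈ U i
      · rw [hfix _ (hgU z hz)]
        exact (g4 z).trans (hd i hi)
      · rw [g3 z hz]
        exact h3 z
    · intro z hz
      simp only [Homeomorph.trans_apply]
      rw [g3 z (hz i hi)]
      exact h4 z (fun j hj => hz j (Finset.mem_insert_of_mem hj))


/-- simple cycles in the transition graph of the itinerary `s` -/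
structure Cyc {S : Type*} (s : ℕ → S) (m : ℕ) (e : ℕ → ℕ) : Prop where
  pos : 0 < m
  edge : ∀ k < m, s (e k + 1) = s (e (k + 1))
  clos : e m = e 0
  inj : ∀ k < m, ∀ l < m, s (e k) = s (e l) → k = l

lemma Cyc.card_le {S : Type*} [Fintype S] {s : ℕ → S} {m : ℕ} {e : ℕ → ℕ} (h : Cyc s m e) :
    m ≤ Fintype.card S := by
  have := Fintype.card_le_of_injective (fun k : Fin m => s (e k)) (by
    intro a b hab
    exact Fin.ext (h.inj a a.2 b b.2 hab))
  simpa using this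

lemma graph_lemma {S : Type*} [Fintype S] (s : ℕ → S) (b : ℕ → ℝ) (Bd : ℝ)
    (hb : ∀ l, -Bd ≤ b l) (hBd : 0 ≤ Bd)
    (hc : ∀ m e, Cyc s m e → 0 ≤ ∑ k ∈ Finset.range m, b (e k)) :
    ∀ (N : ℕ) (e : ℕ → ℕ), (∀ k, k + 1 < N → s (e k + 1) = s (e (k + 1))) →
      -(Bd * Fintype.card S) ≤ ∑ k ∈ Finset.range N, b (e k) := by
  intro N
  induction N using Nat.strong_induction_on with
  | _ N ih =>
  intro e he
  by_cases hN : N ≤ Fintype.card S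
  · have h1 : ∑ k ∈ Finset.range N, (-Bd) ≤ ∑ k ∈ Finset.range N, b (e k) :=
      Finset.sum_le_sum (fun k _ => hb _)
    rw [Finset.sum_const, Finset.card_range, nsmul_eq_mul] at h1
    have : (N : ℝ) ≤ Fintype.card S := by exact_mod_cast hN
    nlinarith
  push Not at hN
  have hex : ∃ t, t < N ∧ ∃ a < t, s (e a) = s (e t) := by
    obtain ⟨x, y, hxy, hs⟩ := Fintype.exists_ne_map_eq_of_card_lt
      (fun k : Fin N => s (e k)) (by simpa using hN)
    have hne : (x : ℕ) ≠ y := fun h => hxy (Fin.ext h)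
    rcases lt_or_gt_of_ne hne with h | h
    · exact ⟨y, y.2, x, h, hs⟩
    · exact ⟨x, x.2, y, h, hs.symm⟩
  classical
  obtain ⟨htN, a, hat, hs⟩ := Nat.find_spec hex
  set t := Nat.find hex with ht
  have hmin : ∀ k < t, ∀ l < t, s (e k) = s (e l) → k = l := by
    intro k hk l hl hkl
    by_contra hne
    rcases lt_or_gt_of_ne hne with h | h
    · exact Nat.find_min hex hl ⟨by omega, k, h, hkl⟩
    · exact Nat.find_min hex hk ⟨by omega, l, h, hkl.symm⟩
  set m := t - a with hm
  have hcyc : Cyc s m (fun k => if k < m then e (a + k) else e a) := by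
    refine ⟨by omega, ?_, ?_, ?_⟩
    · intro k hk
      simp only [hk, if_true]
      by_cases hk1 : k + 1 < m
      · simp only [hk1, if_true]
        exact he (a + k) (by omega)
      · simp only [hk1, if_false]
        rw [hs, he (a + k) (by omega)]
        congr 2; omega
    · have : 0 < m := by omega
      simp [this]
    · intro k hk l hl hkl
      simp only [hk, hl, if_true] at hkl
      have := hmin _ (by omega) _ (by omega) hkl
      omega
  have h1 := hc _ _ hcyc
  have h1' : ∑ k ∈ Finset.range m, b (if k < m then e (a + k) else e a) =
      ∑ k ∈ Finset.range m, b (e (a + k)) := by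
    apply Finset.sum_congr rfl
    intro k hk
    rw [if_pos (Finset.mem_range.1 hk)]
  rw [h1'] at h1
  have h2 := ih (N - m) (by omega) (fun k => if k < a then e k else e (k + m)) (by
    intro k hk
    by_cases h : k < a
    · by_cases h' : k + 1 < a
      · simp only [h, h', if_true]
        exact he k (by omega)
      · simp only [h, h', if_true, if_false]
        have e1 : k + 1 + m = t := by omega
        rw [e1, ← hs, he k (by omega)]
        congr 2; omega
    · have h' : ¬ k + 1 < a := by omega
      simp only [h, h', if_false]
      rw [he (k + m) (by omega)]
      congr 2; omega)
  have e1 : N = a + (m + (N - t)) := by omega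
  have e2 : N - m = a + (N - t) := by omega
  rw [e2, Finset.sum_range_add] at h2
  rw [e1, Finset.sum_range_add, Finset.sum_range_add]
  have e3 : ∑ k ∈ Finset.range a, b (if k < a then e k else e (k + m)) =
      ∑ k ∈ Finset.range a, b (e k) := by
    apply Finset.sum_congr rfl
    intro k hk
    rw [if_pos (Finset.mem_range.1 hk)]
  have e4 : ∑ k ∈ Finset.range (N - t), b (if a + k < a then e (a + k) else e (a + k + m)) =
      ∑ k ∈ Finset.range (N - t), b (e (a + (m + k))) := by
    apply Finset.sum_congr rfl
    intro k hk
    rw [if_neg (by omega)]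
    congr 2; ring
  rw [e3, e4] at h2
  linarith


/-- index of the small cell containing a point -/
def fl (M : ℕ) (t : ℝ) (z : R2) (i : Fin 2) : ℤ := ⌊(M : ℝ) * (z i - t)⌋

lemma fl_add (M : ℕ) (t : ℝ) (z : R2) (w : Fin 2 → ℤ) (i : Fin 2) :
    fl M t (z + iv w) i = fl M t z i + M * w i := by
  unfold fl
  have : (M : ℝ) * ((z + iv w) i - t) = (M : ℝ) * (z i - t) + ((M * w i : ℤ) : ℝ) := by
    simp only [PiLp.add_apply, iv_apply]; push_cast; ring
  rw [this, Int.floor_add_intCast]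

/-- periodic open cells -/
def Cell (M : ℕ) (t : ℝ) (c : Fin 2 → ZMod M) : Set R2 :=
  ⋃ κ ∈ {κ : Fin 2 → ℤ | ∀ i, (κ i : ZMod M) = c i},
    {z : R2 | ∀ i, (κ i : ℝ) < M * (z i - t) ∧ (M : ℝ) * (z i - t) < κ i + 1}

lemma Cell_open (M : ℕ) (t : ℝ) (c : Fin 2 → ZMod M) : IsOpen (Cell M t c) := by
  apply isOpen_biUnion
  intro κ _
  simp only [Set.ofPred_forall, Set.ofPred_and]
  apply isOpen_iInter_of_finite
  intro i
  apply IsOpen.inter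
  · exact isOpen_lt (by fun_prop) (by fun_prop)
  · exact isOpen_lt (by fun_prop) (by fun_prop)

lemma mem_Cell {M : ℕ} {t : ℝ} {c : Fin 2 → ZMod M} {z : R2} : z ∈ Cell M t c ↔
    (∀ i, (fl M t z i : ZMod M) = c i) ∧
      ∀ i, (fl M t z i : ℝ) < M * (z i - t) := by
  unfold Cell
  simp only [mem_iUnion, mem_ofPred_eq, exists_prop]
  constructor
  · rintro ⟨κ, h1, h2⟩
    have : ∀ i, fl M t z i = κ i := by
      intro i
      unfold fl
      rw [Int.floor_eq_iff]
      exact ⟨(h2 i).1.le, (h2 i).2⟩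
    exact ⟨fun i => by rw [this, h1], fun i => by rw [this]; exact (h2 i).1⟩
  · rintro ⟨h1, h2⟩
    exact ⟨fl M t z, h1, fun i => ⟨h2 i, Int.lt_floor_add_one _⟩⟩

lemma Cell_per (M : ℕ) (t : ℝ) (c : Fin 2 → ZMod M) : ∀ z ∈ Cell M t c, ∀ w ∈ intLattice,
    z + w ∈ Cell M t c := by
  intro z hz w hw
  obtain ⟨k, rfl⟩ := (mem_iff_iv w).1 hw
  rw [mem_Cell] at hz ⊢
  refine ⟨fun i => ?_, fun i => ?_⟩
  · rw [fl_add]; push_cast; rw [hz.1 i]; simp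
  · rw [fl_add]
    have := hz.2 i
    simp only [PiLp.add_apply, iv_apply]; push_cast; linarith

lemma Cell_seg {M : ℕ} {t : ℝ} {c : Fin 2 → ZMod M} {a b : R2}
    (ha : a ∈ Cell M t c) (hb : b ∈ Cell M t c) (hab : ∀ i, fl M t a i = fl M t b i) :
    segment ℝ a b ⊆ Cell M t c := by
  have hconv : Convex ℝ {z : R2 | ∀ i, (fl M t a i : ℝ) < M * (z i - t) ∧
      (M : ℝ) * (z i - t) < fl M t a i + 1} := by
    intro x hx y hy α β hα hβ hαβ i
    have h1 := hx i
    have h2 := hy i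
    simp only [PiLp.add_apply, PiLp.smul_apply, smul_eq_mul]
    have e : (M : ℝ) * (α * x i + β * y i - t) = α * (M * (x i - t)) + β * (M * (y i - t)) := by
      have : β = 1 - α := by linarith
      subst this; ring
    rw [e]
    have e2 : (fl M t a i : ℝ) = α * fl M t a i + β * fl M t a i := by
      rw [← add_mul, hαβ, one_mul]
    rcases hα.lt_or_eq with h | h
    · constructor <;> nlinarith
    · have hβ1 : β = 1 := by linarith
      subst h; subst hβ1; simpa using h2
  have hsub := hconv.segment_subset (x := a) (y := b)
    (fun i => ⟨(mem_Cell.1 ha).2 i, Int.lt_floor_add_one _⟩)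
    (fun i => by rw [hab]; exact ⟨(mem_Cell.1 hb).2 i, Int.lt_floor_add_one _⟩)
  refine hsub.trans ?_
  intro z hz
  unfold Cell
  simp only [mem_iUnion, exists_prop]
  exact ⟨fl M t a, (mem_Cell.1 ha).1, hz⟩

lemma fl_diff {M : ℕ} (hM : 0 < M) {t : ℝ} (z : R2) (i : Fin 2) :
    |(M : ℝ)⁻¹ * fl M t z i - (z i - t)| ≤ (M : ℝ)⁻¹ := by
  have hMR : (0 : ℝ) < M := by exact_mod_cast hM
  have h1 := Int.floor_le ((M : ℝ) * (z i - t))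
  have h2 := Int.lt_floor_add_one ((M : ℝ) * (z i - t))
  have e : (M : ℝ)⁻¹ * fl M t z i - (z i - t) = (M : ℝ)⁻¹ * (fl M t z i - M * (z i - t)) := by
    field_simp
  rw [e, abs_mul, abs_of_pos (inv_pos.2 hMR)]
  apply mul_le_of_le_one_right (inv_pos.2 hMR).le
  unfold fl
  rw [abs_le]; constructor <;> linarith

lemma cyc_real (F : R2 ≃ₜ R2) (hF : Equi F) (M : ℕ) (hM : 0 < M) (t : ℝ) (y : ℕ → R2)
    (hy : ∀ l, y (l + 1) = F (y l))
    (hgen : ∀ l i, (fl M t (y l) i : ℝ) < M * (y l i - t)) (m : ℕ) (e : ℕ → ℕ)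
    (hc : Cyc (fun l i => (fl M t (y l) i : ZMod M)) m e) :
    ∃ (G : R2 ≃ₜ R2) (x : R2) (w : Fin 2 → ℤ), Equi G ∧ (∀ z, ‖G z - F z‖ ≤ 2 / M) ∧
      (∀ i, (M : ℤ) * w i = ∑ k ∈ Finset.range m, (fl M t (y (e k + 1)) i - fl M t (y (e k)) i)) ∧
      (⇑G)^[m] x = x + iv w ∧
      ∀ i < m, ∀ j < m, (⇑G)^[i] x - (⇑G)^[j] x ∈ intLattice → i = j := by
  have hMR : (0 : ℝ) < M := by exact_mod_cast hM
  have hMZ : (M : ℤ) ≠ 0 := by exact_mod_cast hM.ne'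
  set D : ℕ → Fin 2 → ℤ := fun k i => (fl M t (y (e k + 1)) i - fl M t (y (e (k + 1))) i) / M with hD
  have hDM : ∀ k < m, ∀ i, (M : ℤ) * D k i = fl M t (y (e k + 1)) i - fl M t (y (e (k + 1))) i := by
    intro k hk i
    apply Int.mul_ediv_cancel'
    have := congrFun (hc.edge k hk) i
    rw [← ZMod.intCast_zmod_eq_zero_iff_dvd]
    push_cast
    rw [this]; simp
  set W : ℕ → Fin 2 → ℤ := fun k i => ∑ j ∈ Finset.range k, D j i with hW
  have hWs : ∀ k, iv (W (k + 1)) = iv (W k) + iv (D k) := by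
    intro k; ext i; simp [hW, Finset.sum_range_succ]
  set X : ℕ → R2 := fun k => y (e k) + iv (W k) with hX
  have hFX : ∀ k, F (X k) = y (e k + 1) + iv (W k) := by
    intro k
    simp only [hX]
    rw [hF _ _ (iv_mem _), hy]
  have hsame : ∀ k < m, ∀ i, fl M t (F (X k)) i = fl M t (X (k + 1)) i := by
    intro k hk i
    rw [hFX]
    simp only [hX]
    rw [hWs, fl_add, ← add_assoc, fl_add, fl_add, hDM k hk]
    ring
  have hmemX : ∀ k, X k ∈ Cell M t (fun i => (fl M t (y (e k)) i : ZMod M)) := by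
    intro k
    apply Cell_per _ _ _ _ _ _ (iv_mem _)
    rw [mem_Cell]
    exact ⟨fun i => rfl, fun i => hgen _ i⟩
  have hmemF : ∀ k < m, F (X k) ∈ Cell M t (fun i => (fl M t (y (e (k + 1))) i : ZMod M)) := by
    intro k hk
    rw [mem_Cell]
    constructor
    · intro i
      rw [hsame k hk]
      exact (mem_Cell.1 (hmemX (k + 1))).1 i
    · intro i
      have := (mem_Cell.1 (Cell_per M t _ _ (mem_Cell.2 ⟨fun i => rfl, fun i => hgen (e k + 1) i⟩) _
        (iv_mem (W k)))).2 i
      rw [hFX]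
      exact this
  have hinj' : ∀ k < m, ∀ l < m, (fun i => (fl M t (y (e (k + 1))) i : ZMod M)) =
      (fun i => (fl M t (y (e (l + 1))) i : ZMod M)) → k = l := by
    have hm := hc.pos
    have hcl := hc.clos
    intro k hk l hl hkl
    rcases Nat.lt_or_ge (k + 1) m with h1 | h1
    · rcases Nat.lt_or_ge (l + 1) m with h2 | h2
      · have := hc.inj _ h1 _ h2 hkl
        omega
      · have e1 : l + 1 = m := by omega
        rw [e1, hcl] at hkl
        have := hc.inj _ h1 _ hm hkl
        omega
    · have e1 : k + 1 = m := by omega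
      rcases Nat.lt_or_ge (l + 1) m with h2 | h2
      · rw [e1, hcl] at hkl
        have := hc.inj _ hm _ h2 hkl
        omega
      · omega
  obtain ⟨H, H1, H2, H3, -⟩ := multi_move (Finset.range m) (fun k => F (X k)) (fun k => X (k + 1))
    (fun k => Cell M t (fun i => (fl M t (y (e (k + 1))) i : ZMod M))) (2 / M) (by positivity)
    (fun k _ => Cell_open _ _ _) (fun k _ => Cell_per _ _ _)
    (by
      intro k hk l hl hkl
      rw [Set.disjoint_left]
      intro z h1 h2
      apply hkl
      apply hinj' k (Finset.mem_range.1 hk) l (Finset.mem_range.1 hl)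
      funext i
      rw [← (mem_Cell.1 h1).1 i, ← (mem_Cell.1 h2).1 i])
    (by
      intro k hk
      exact Cell_seg (hmemF k (Finset.mem_range.1 hk)) (hmemX (k + 1)) (hsame k (Finset.mem_range.1 hk)))
    (by
      intro k hk
      have hk := Finset.mem_range.1 hk
      have := norm_le_of_coord (X (k + 1) - F (X k)) (1 / M) (by
        intro i
        have h := hsame k hk i
        have h1 := Int.floor_le ((M : ℝ) * (F (X k) i - t))
        have h2 := Int.lt_floor_add_one ((M : ℝ) * (F (X k) i - t))
        have h3 := Int.floor_le ((M : ℝ) * (X (k + 1) i - t))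
        have h4 := Int.lt_floor_add_one ((M : ℝ) * (X (k + 1) i - t))
        unfold fl at h
        rw [← h] at h3 h4
        simp only [PiLp.sub_apply]
        have h5 : |((X (k + 1)) i - (F (X k)) i) * (M : ℝ)| ≤ 1 := by
          rw [abs_le]
          constructor <;> linarith
        rw [abs_mul, abs_of_pos hMR] at h5
        rwa [le_div_iff₀ hMR])
      refine this.trans (le_of_eq ?_)
      ring)
  have hit : ∀ k ≤ m, (⇑(F.trans H))^[k] (X 0) = X k := by
    intro k
    induction k with
    | zero => intro _; rfl
    | succ k ih =>
      intro hk
      rw [Function.iterate_succ_apply', ih (by omega), Homeomorph.trans_apply]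
      exact H2 k (Finset.mem_range.2 (by omega))
  refine ⟨F.trans H, X 0, W m, Equi.comp (F := H) (G := F) H1 hF, ?_, ?_, ?_, ?_⟩
  · intro z
    exact H3 (F z)
  · intro i
    simp only [hW, Finset.mul_sum]
    rw [Finset.sum_congr rfl (fun k hk => hDM k (Finset.mem_range.1 hk) i)]
    rw [Finset.sum_sub_distrib, Finset.sum_sub_distrib]
    have h1 := Finset.sum_range_succ (fun k => fl M t (y (e k)) i) m
    have h2 := Finset.sum_range_succ' (fun k => fl M t (y (e k)) i) m
    rw [hc.clos] at h1
    linarith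
  · rw [hit m le_rfl]
    have h0 : iv (W 0) = 0 := by ext i; simp [hW]
    simp only [hX]
    rw [hc.clos, h0, add_zero]
  · intro i hi j hj hij
    rw [hit i hi.le, hit j hj.le] at hij
    obtain ⟨w, hw⟩ := (mem_iff_iv _).1 hij
    have e1 : X i = X j + iv w := by rw [← hw]; abel
    have h1 := hmemX i
    have h2 := Cell_per _ _ _ _ (hmemX j) _ (iv_mem w)
    rw [e1] at h1
    apply hc.inj i hi j hj
    funext κ
    have a1 := (mem_Cell.1 h1).1 κ
    have a2 := (mem_Cell.1 h2).1 κ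
    rw [← a1, a2]

lemma exists_generic (M : ℕ) (hM : 0 < M) (y : ℕ → R2) :
    ∃ t : ℝ, ∀ l i, (fl M t (y l) i : ℝ) < M * (y l i - t) := by
  have hMR : (0 : ℝ) < M := by exact_mod_cast hM
  have hcount : (range fun p : ℕ × Fin 2 × ℤ => y p.1 p.2.1 - p.2.2 / M).Countable :=
    countable_range _
  obtain ⟨t, ht⟩ := (hcount.dense_compl ℝ).nonempty
  refine ⟨t, fun l i => lt_of_le_of_ne (Int.floor_le _) ?_⟩
  intro h
  apply ht
  refine ⟨(l, i, fl M t (y l) i), ?_⟩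
  simp only
  rw [h]
  field_simp
  ring

lemma rot_ge (F : R2 ≃ₜ R2) (ℓ : R2 →L[ℝ] ℝ) (u C : ℝ)
    (h : ∀ z (N : ℕ), u * N - C ≤ ℓ ((⇑F)^[N] z - z)) (v : R2) (hv : v ∈ rotSet F) : u ≤ ℓ v := by
  obtain ⟨z, n, hn, hlim⟩ := hv
  have h1 := (ℓ.continuous.tendsto v).comp hlim
  have hinv : Tendsto (fun k => (n k : ℝ)⁻¹) atTop (𝓝 0) :=
    tendsto_inv_atTop_zero.comp (tendsto_natCast_atTop_atTop.comp hn)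
  have h2 : Tendsto (fun k => u - C * (n k : ℝ)⁻¹) atTop (𝓝 (u - C * 0)) :=
    tendsto_const_nhds.sub (hinv.const_mul C)
  rw [mul_zero, sub_zero] at h2
  refine le_of_tendsto_of_tendsto h2 h1 ?_
  filter_upwards [hn.eventually_ge_atTop 1] with k hk
  have hk0 : (0 : ℝ) < n k := by exact_mod_cast hk
  simp only [Function.comp_apply, map_smul, smul_eq_mul]
  have := h (z k) (n k)
  have e : u - C * (n k : ℝ)⁻¹ = (n k : ℝ)⁻¹ * (u * n k - C) := by field_simp
  rw [e]
  gcongr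

lemma step_A (F : R2 ≃ₜ R2) (hF : Equi F) (v : R2) (hv : v ∈ Set.extremePoints ℝ (rotSet F))
    (M : ℕ) (hM : 0 < M)
    (hst : ∀ G : R2 ≃ₜ R2, Equi G → (∀ z, ‖G z - F z‖ ≤ 2 / M) → rotSet G ⊆ rotSet F) :
    ∃ (G : R2 ≃ₜ R2) (x : R2) (m : ℕ) (w : Fin 2 → ℤ), Equi G ∧ (∀ z, ‖G z - F z‖ ≤ 2 / M) ∧
      0 < m ∧ (⇑G)^[m] x = x + iv w ∧ (m : ℝ)⁻¹ • iv w = v ∧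
      ∀ i < m, ∀ j < m, (⇑G)^[i] x - (⇑G)^[j] x ∈ intLattice → i = j := by
  by_contra hcon
  push Not at hcon
  have hMR : (0 : ℝ) < M := by exact_mod_cast hM
  have hM1 : (M : ℝ)⁻¹ ≤ 1 := inv_le_one_of_one_le₀ (by exact_mod_cast hM)
  have : NeZero M := ⟨hM.ne'⟩
  obtain ⟨B, hB0, hB⟩ := hF.bounded F.continuous
  set card : ℕ := Fintype.card (Fin 2 → ZMod M) with hcard
  obtain ⟨R, hR⟩ := exists_nat_gt (card * (B + 2))
  set V : Set R2 := {c | (∃ (m : ℕ) (w : Fin 2 → ℤ), m ≤ card ∧ (∀ i, |w i| ≤ R) ∧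
    c = (m : ℝ)⁻¹ • iv w) ∧ c ∈ rotSet F ∧ c ≠ v} with hV
  have hVfin : V.Finite := by
    have hfin : ((Set.Iic card) ×ˢ (Set.Icc (fun _ => -(R : ℤ)) (fun _ => (R : ℤ)) :
      Set (Fin 2 → ℤ))).Finite := (Set.finite_Iic _).prod (Set.finite_Icc _ _)
    refine (hfin.image (fun p => ((p.1 : ℕ) : ℝ)⁻¹ • iv p.2)).subset ?_
    rintro c ⟨⟨m, w, h1, h2, rfl⟩, -⟩
    refine ⟨(m, w), ⟨h1, fun i => (abs_le.1 (h2 i)).1, fun i => (abs_le.1 (h2 i)).2⟩, rfl⟩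
  have hVK : V ⊆ rotSet F := fun c hc => hc.2.1
  have hvV : v ∉ convexHull ℝ V := by
    intro h
    have h1 : convexHull ℝ V ⊆ rotSet F := convexHull_min hVK (rot_convex F hF)
    have h2 := inter_extremePoints_subset_extremePoints_of_subset h1 ⟨h, hv⟩
    exact (extremePoints_convexHull_subset h2).2.2 rfl
  obtain ⟨ℓ, u, hℓv, hℓ⟩ := geometric_hahn_banach_point_closed (convex_convexHull ℝ V)
    (hVfin.isClosed_convexHull ℝ) hvV
  refine absurd hℓv (not_lt.2 ?_)
  set Bd : ℝ := ‖ℓ‖ * (2 * (B + 2)) + |u| with hBd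
  refine rot_ge F ℓ u (Bd * card + ‖ℓ‖ * 4) ?_ v hv.1
  intro z N
  set y : ℕ → R2 := fun l => (⇑F)^[l] z with hy
  have hys : ∀ l, y (l + 1) = F (y l) := fun l => Function.iterate_succ_apply' _ _ _
  obtain ⟨t, ht⟩ := exists_generic M hM y
  set s : ℕ → Fin 2 → ZMod M := fun l i => (fl M t (y l) i : ZMod M) with hs
  set d : ℕ → R2 := fun l => (M : ℝ)⁻¹ • iv (fun i => fl M t (y (l + 1)) i - fl M t (y l) i) with hd
  have hdc : ∀ l i, |d l i| ≤ B + 2 := by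
    intro l i
    have h1 := fl_diff hM (t := t) (y l) i
    have h2 := fl_diff hM (t := t) (y (l + 1)) i
    have h3 := (abs_coord_le (F (y l) - y l) i).trans (hB (y l))
    rw [← hys] at h3
    simp only [PiLp.sub_apply] at h3
    simp only [hd, PiLp.smul_apply, iv_apply, smul_eq_mul]
    push_cast
    rw [abs_le] at *
    constructor <;> linarith
  have hdn : ∀ l, ‖d l‖ ≤ 2 * (B + 2) := fun l => norm_le_of_coord _ _ (hdc l)
  have hb : ∀ l, -Bd ≤ ℓ (d l) - u := by
    intro l
    have h1 : |ℓ (d l)| ≤ ‖ℓ‖ * (2 * (B + 2)) :=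
      (ℓ.le_opNorm _).trans (by gcongr; exact hdn l)
    have h2 := abs_le.1 h1
    have h3 := le_abs_self u
    linarith
  have hcycle : ∀ m e, Cyc s m e → 0 ≤ ∑ k ∈ Finset.range m, (ℓ (d (e k)) - u) := by
    intro m e hc
    obtain ⟨G, x, w, hG, hGF, hw, hper, hdist⟩ := cyc_real F hF M hM t y hys ht m e hc
    have hm := hc.pos
    have hmR : (0 : ℝ) < m := by exact_mod_cast hm
    have hmc : m ≤ card := hc.card_le
    have hne : (m : ℝ)⁻¹ • iv w ≠ v := by
      intro h
      obtain ⟨i, hi, j, hj, hij, hne⟩ := hcon G x m w hG hGF hm hper h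
      exact hne (hdist i hi j hj hij)
    have hiw : iv w = ∑ k ∈ Finset.range m, d (e k) := by
      ext i
      have h1 : (M : ℝ) * w i = ∑ k ∈ Finset.range m,
          ((fl M t (y (e k + 1)) i : ℝ) - fl M t (y (e k)) i) := by exact_mod_cast hw i
      have h2 : (w i : ℝ) = (M : ℝ)⁻¹ * (M * w i) := by field_simp
      rw [iv_apply, h2, h1]
      rw [Finset.mul_sum]
      simp [hd]
    have hwb : ∀ i, |w i| ≤ R := by
      intro i
      have h1 : |(w i : ℝ)| ≤ m * (B + 2) := by
        rw [← iv_apply, hiw]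
        have : (∑ k ∈ Finset.range m, d (e k)) i = ∑ k ∈ Finset.range m, d (e k) i := by simp
        rw [this]
        refine (Finset.abs_sum_le_sum_abs _ _).trans ?_
        refine (Finset.sum_le_sum (fun k _ => hdc (e k) i)).trans ?_
        simp [mul_add]
      have h2 : (m : ℝ) ≤ card := by exact_mod_cast hmc
      have h3 : |(w i : ℝ)| ≤ R := by nlinarith
      exact_mod_cast h3
    have hmem : (m : ℝ)⁻¹ • iv w ∈ V :=
      ⟨⟨m, w, hmc, hwb, rfl⟩, hst G hG hGF (per_rot G hG hm (iv_mem w) hper), hne⟩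
    have h1 := hℓ _ (subset_convexHull ℝ V hmem)
    rw [map_smul, smul_eq_mul, hiw, map_sum] at h1
    rw [Finset.sum_sub_distrib, Finset.sum_const, Finset.card_range, nsmul_eq_mul]
    rw [lt_inv_mul_iff₀ hmR] at h1
    linarith
  have hg := graph_lemma s (fun l => ℓ (d l) - u) Bd hb (by positivity) hcycle N (fun k => k)
    (fun k _ => rfl)
  rw [Finset.sum_sub_distrib, Finset.sum_const, Finset.card_range, nsmul_eq_mul, ← map_sum] at hg
  have htel : ∀ N : ℕ, ∑ k ∈ Finset.range N, d k =
      (M : ℝ)⁻¹ • iv (fun i => fl M t (y N) i - fl M t (y 0) i) := by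
    intro N
    induction N with
    | zero => ext i; simp
    | succ N ih =>
      rw [Finset.sum_range_succ, ih]
      ext i
      simp [hd]
      ring
  have hnear : ‖∑ k ∈ Finset.range N, d k - (y N - y 0)‖ ≤ 4 := by
    have := norm_le_of_coord (∑ k ∈ Finset.range N, d k - (y N - y 0)) 2 (by
      intro i
      have h1 := fl_diff hM (t := t) (y N) i
      have h2 := fl_diff hM (t := t) (y 0) i
      rw [htel]
      simp only [PiLp.sub_apply, PiLp.smul_apply, iv_apply, smul_eq_mul]
      push_cast
      rw [abs_le] at *
      constructor <;> linarith)
    linarith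
  have h5 : |ℓ (∑ k ∈ Finset.range N, d k - (y N - y 0))| ≤ ‖ℓ‖ * 4 :=
    (ℓ.le_opNorm _).trans (by gcongr)
  rw [map_sub] at h5
  have h6 := (abs_le.1 h5).2
  have h7 : ℓ (y N - y 0) = ℓ ((⇑F)^[N] z - z) := rfl
  rw [← h7]
  linarith


lemma three_pts (a b c : R2) : ‖a - b‖ ^ 2 + ‖b - c‖ ^ 2 + ‖a - c‖ ^ 2 ≤
    3 * (‖a‖ ^ 2 + ‖b‖ ^ 2 + ‖c‖ ^ 2) := by
  simp only [EuclideanSpace.real_norm_sq_eq, Fin.sum_univ_two, PiLp.sub_apply]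
  nlinarith [sq_nonneg (a 0 + b 0 + c 0), sq_nonneg (a 1 + b 1 + c 1)]

lemma count_le {ι : Type*} [DecidableEq ι] (I : Finset ι) (c : ι → R2) (r : ℝ) (hr : 0 < r)
    (hsep : ∀ p ∈ I, ∀ p' ∈ I, p ≠ p' → 2 * r ≤ ‖c p - c p'‖) (y : R2) :
    ∑ p ∈ I, ((ball (c p) (0.9 * r)).indicator (1 : R2 → ENNReal) y +
      (ball (c p) (1.1 * r)).indicator (1 : R2 → ENNReal) y) ≤ 2 := by
  classical
  have h : ∀ s : ℝ, ∑ p ∈ I, (ball (c p) s).indicator (1 : R2 → ENNReal) y =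
      ((I.filter (fun p => y ∈ ball (c p) s)).card : ENNReal) := by
    intro s
    simp only [Set.indicator_apply, Pi.one_apply]
    rw [Finset.sum_boole]
  rw [Finset.sum_add_distrib, h, h]
  have key : (I.filter (fun p => y ∈ ball (c p) (0.9 * r))).card +
      (I.filter (fun p => y ∈ ball (c p) (1.1 * r))).card ≤ 2 := by
    by_cases hne : (I.filter (fun p => y ∈ ball (c p) (0.9 * r))).Nonempty
    · obtain ⟨p₀, hp₀⟩ := hne
      rw [Finset.mem_filter, mem_ball, dist_eq_norm] at hp₀
      have hT : ∀ s : ℝ, s ≤ 1.1 * r →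
          (I.filter (fun p => y ∈ ball (c p) s)).card ≤ 1 := by
        intro s hs
        rw [← Finset.card_singleton p₀]
        apply Finset.card_le_card
        intro p hp
        rw [Finset.mem_filter, mem_ball, dist_eq_norm] at hp
        rw [Finset.mem_singleton]
        by_contra hpp
        have h1 := hsep p hp.1 p₀ hp₀.1 hpp
        have h2 : ‖c p - c p₀‖ ≤ ‖y - c p‖ + ‖y - c p₀‖ := by
          have : c p - c p₀ = (y - c p₀) - (y - c p) := by abel
          rw [this]
          refine (norm_sub_le _ _).trans ?_
          linarith
        linarith [hp.2, hp₀.2]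
      have h1 := hT (0.9 * r) (by linarith)
      have h2 := hT (1.1 * r) le_rfl
      omega
    · rw [Finset.not_nonempty_iff_eq_empty] at hne
      rw [hne, Finset.card_empty, zero_add]
      by_contra hlt
      push Not at hlt
      obtain ⟨a, b, d, ha, hb, hd, hab, had, hbd⟩ := Finset.two_lt_card_iff.1 hlt
      rw [Finset.mem_filter, mem_ball, dist_comm, dist_eq_norm] at ha hb hd
      have h1 := hsep a ha.1 b hb.1 hab
      have h2 := hsep a ha.1 d hd.1 had
      have h3 := hsep b hb.1 d hd.1 hbd
      have h4 := three_pts (c a - y) (c b - y) (c d - y)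
      simp only [sub_sub_sub_cancel_right] at h4
      have h5 := pow_le_pow_left₀ (by positivity) h1 2
      have h6 := pow_le_pow_left₀ (by positivity) h2 2
      have h7 := pow_le_pow_left₀ (by positivity) h3 2
      have h8 := pow_le_pow_left₀ (norm_nonneg _) ha.2.le 2
      have h9 := pow_le_pow_left₀ (norm_nonneg _) hb.2.le 2
      have h10 := pow_le_pow_left₀ (norm_nonneg _) hd.2.le 2
      nlinarith [sq_nonneg r, mul_pos hr hr]
  exact_mod_cast key

lemma vol_box (a b : ℝ) : volume {z : R2 | ∀ i, z i ∈ Icc a b} = ENNReal.ofReal (b - a) ^ 2 := by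
  have h := (EuclideanSpace.volume_preserving_symm_measurableEquiv_toLp (Fin 2)).measure_preimage
    (s := Icc (fun _ => a) (fun _ => b)) measurableSet_Icc.nullMeasurableSet
  rw [Real.volume_Icc_pi] at h
  simp only [Finset.prod_const, Finset.card_univ, Fintype.card_fin] at h
  rw [← h]
  congr 1
  ext z
  simp only [mem_ofPred_eq, mem_preimage, mem_Icc, Pi.le_def]
  exact ⟨fun h => ⟨fun i => (h i).1, fun i => (h i).2⟩, fun h i => ⟨h.1 i, h.2 i⟩⟩

lemma area_le {ι : Type*} [DecidableEq ι] (I : Finset ι) (c : ι → R2) (r : ℝ) (hr : 0 < r)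
    (hsep : ∀ p ∈ I, ∀ p' ∈ I, p ≠ p' → 2 * r ≤ ‖c p - c p'‖) (a b : ℝ) (hab : a ≤ b)
    (hbox : ∀ p ∈ I, ∀ i, c p i ∈ Icc (a + 1.1 * r) (b - 1.1 * r)) :
    (I.card : ℝ) * (2.02 * r ^ 2 * Real.pi) ≤ 2 * (b - a) ^ 2 := by
  have hint : ∫⁻ y, ∑ p ∈ I, ((ball (c p) (0.9 * r)).indicator (1 : R2 → ENNReal) y +
      (ball (c p) (1.1 * r)).indicator (1 : R2 → ENNReal) y) =
      ∑ p ∈ I, (volume (ball (c p) (0.9 * r)) + volume (ball (c p) (1.1 * r))) := by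
    rw [lintegral_finsetSum]
    · apply Finset.sum_congr rfl
      intro p _
      rw [lintegral_add_left]
      · rw [lintegral_indicator_one measurableSet_ball, lintegral_indicator_one measurableSet_ball]
      · exact measurable_one.indicator measurableSet_ball
    · intro p _
      exact (measurable_one.indicator measurableSet_ball).add
        (measurable_one.indicator measurableSet_ball)
  set Q : Set R2 := {z : R2 | ∀ i, z i ∈ Icc a b} with hQ
  have hQm : MeasurableSet Q := by
    have : IsClosed Q := by
      simp only [hQ, Set.ofPred_forall]
      apply isClosed_iInter
      intro i
      exact isClosed_Icc.preimage (by fun_prop : Continuous fun z : R2 => z i)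
    exact this.measurableSet
  have hle : ∫⁻ y, ∑ p ∈ I, ((ball (c p) (0.9 * r)).indicator (1 : R2 → ENNReal) y +
      (ball (c p) (1.1 * r)).indicator (1 : R2 → ENNReal) y) ≤ ∫⁻ y, Q.indicator (fun _ => 2) y := by
    apply lintegral_mono
    intro y
    by_cases hy : y ∈ Q
    · simp only [Set.indicator_of_mem hy]
      exact count_le I c r hr hsep y
    · simp only [Set.indicator_of_notMem hy]
      rw [nonpos_iff_eq_zero]
      apply Finset.sum_eq_zero
      intro p hp
      have hn : ∀ s, s ≤ 1.1 * r → y ∉ ball (c p) s := by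
        intro s hs hys
        apply hy
        intro i
        rw [mem_ball, dist_eq_norm] at hys
        have h1 := abs_coord_le (y - c p) i
        have h2 := hbox p hp i
        simp only [PiLp.sub_apply] at h1
        rw [mem_Icc] at h2 ⊢
        have h3 := abs_le.1 (h1.trans hys.le)
        constructor <;> linarith [h3.1, h3.2, h2.1, h2.2]
      rw [Set.indicator_of_notMem (hn _ (by linarith)), Set.indicator_of_notMem (hn _ le_rfl),
        add_zero]
  rw [hint, lintegral_indicator_const hQm, vol_box] at hle
  simp only [EuclideanSpace.volume_ball_fin_two] at hle
  rw [Finset.sum_const, nsmul_eq_mul] at hle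
  have hpi := Real.pi_pos
  have e1 : ENNReal.ofReal (0.9 * r) ^ 2 * ENNReal.ofReal Real.pi +
      ENNReal.ofReal (1.1 * r) ^ 2 * ENNReal.ofReal Real.pi =
      ENNReal.ofReal (2.02 * r ^ 2 * Real.pi) := by
    rw [← ENNReal.ofReal_pow (by positivity), ← ENNReal.ofReal_pow (by positivity),
      ← ENNReal.ofReal_mul (by positivity), ← ENNReal.ofReal_mul (by positivity),
      ← ENNReal.ofReal_add (by positivity) (by positivity)]
    congr 1; ring
  have e2 : (2 : ENNReal) * ENNReal.ofReal (b - a) ^ 2 = ENNReal.ofReal (2 * (b - a) ^ 2) := by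
    rw [← ENNReal.ofReal_pow (by linarith), ENNReal.ofReal_mul (by norm_num)]
    simp
  rw [e1, e2, ← ENNReal.ofReal_natCast, ← ENNReal.ofReal_mul (by positivity),
    ENNReal.ofReal_le_ofReal_iff (by positivity)] at hle
  exact hle

lemma packing (q : ℕ) (x : ℕ → R2) (d : ℝ) (hd0 : 0 < d) (hd1 : d ≤ 1)
    (hd : 4 < 1.01 * Real.pi * q * d ^ 2) :
    ∃ i j, i < j ∧ j < q ∧ ∃ w ∈ intLattice, ‖x i + w - x j‖ < d := by
  by_contra hcon
  push Not at hcon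
  obtain ⟨A, hA⟩ : ∃ A : ℝ, ∀ k < q, ‖x k‖ ≤ A := by
    refine ⟨∑ k ∈ Finset.range q, ‖x k‖, fun k hk => ?_⟩
    exact Finset.single_le_sum (f := fun k => ‖x k‖) (fun _ _ => norm_nonneg _)
      (Finset.mem_range.2 hk)
  have hsep0 : ∀ i < q, ∀ j < q, ∀ w : Fin 2 → ℤ, (i ≠ j ∨ w ≠ 0) → d ≤ ‖x i + iv w - x j‖ := by
    intro i hi j hj w h
    rcases lt_trichotomy i j with hij | hij | hij
    · exact hcon i j hij hj _ (iv_mem w)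
    · subst hij
      have hw : w ≠ 0 := by simpa using h
      obtain ⟨κ, hκ⟩ := Function.ne_iff.1 hw
      have h1 := abs_coord_le (iv w) κ
      rw [iv_apply] at h1
      have h2 : (1 : ℝ) ≤ |(w κ : ℝ)| := by
        exact_mod_cast Int.one_le_abs hκ
      have : x i + iv w - x i = iv w := by abel
      rw [this]; linarith
    · have := hcon j i hij hi _ (neg_mem (iv_mem w))
      have e : x i + iv w - x j = -(x j + -iv w - x i) := by abel
      rw [e, norm_neg]; exact this
  have hmain : ∀ N : ℕ, (N : ℝ) ^ 2 * q * (2.02 * (d / 2) ^ 2 * Real.pi) ≤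
      2 * (N + (2 * |A| + 2)) ^ 2 := by
    intro N
    classical
    set I : Finset (ℕ × ℕ × ℕ) := Finset.range q ×ˢ Finset.range N ×ˢ Finset.range N with hI
    set κ : ℕ × ℕ × ℕ → Fin 2 → ℤ := fun p => ![(p.2.1 : ℤ), (p.2.2 : ℤ)] with hκ
    have h := area_le I (fun p => x p.1 + iv (κ p)) (d / 2) (by positivity) (by
      intro p hp p' hp' hne
      have e : x p.1 + iv (κ p) - (x p'.1 + iv (κ p')) =
          x p.1 + iv (κ p - κ p') - x p'.1 := by
        ext i; simp; ring
      rw [e]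
      have hp1 : p.1 < q := by simp [hI] at hp; exact hp.1
      have hp1' : p'.1 < q := by simp [hI] at hp'; exact hp'.1
      have := hsep0 p.1 hp1 p'.1 hp1' (κ p - κ p') (by
        by_contra hc
        push Not at hc
        apply hne
        have h0 := congrFun hc.2 0
        have h1 := congrFun hc.2 1
        simp [hκ] at h0 h1
        ext
        · exact hc.1
        · omega
        · omega)
      linarith) (-(|A| + 1)) (N + |A| + 1) (by have := abs_nonneg A; have : (0:ℝ) ≤ N := Nat.cast_nonneg N; linarith) (by
      intro p hp i
      simp only [hI, Finset.mem_product, Finset.mem_range] at hp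
      have h1 := (abs_coord_le (x p.1) i).trans ((hA p.1 hp.1).trans (le_abs_self A))
      have h2 := abs_le.1 h1
      have h3 : (0 : ℝ) ≤ κ p i ∧ (κ p i : ℝ) ≤ N := by
        have a1 : (p.2.1 : ℝ) ≤ N := by exact_mod_cast hp.2.1.le
        have a2 : (p.2.2 : ℝ) ≤ N := by exact_mod_cast hp.2.2.le
        fin_cases i <;> simp [hκ, a1, a2]
      simp only [PiLp.add_apply, iv_apply, mem_Icc]
      constructor <;> linarith [h2.1, h2.2, h3.1, h3.2])
    have hc : (I.card : ℝ) = N ^ 2 * q := by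
      simp [hI]; ring
    rw [hc] at h
    refine h.trans (le_of_eq ?_)
    ring
  set c : ℝ := 2 * |A| + 2 with hc
  have hc0 : 0 < c := by positivity
  set η : ℝ := q * (2.02 * (d / 2) ^ 2 * Real.pi) - 2 with hη
  have hη0 : 0 < η := by rw [hη]; nlinarith
  obtain ⟨N, hN⟩ := exists_nat_gt ((4 * c + 2 * c ^ 2) / η + 1)
  have h1 := hmain N
  have hN1 : (1 : ℝ) < N := lt_of_le_of_lt (by
    have : 0 ≤ (4 * c + 2 * c ^ 2) / η := by positivity
    linarith) hN
  have h2 : (4 * c + 2 * c ^ 2) < η * N := by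
    have : (4 * c + 2 * c ^ 2) / η < N := by linarith
    rw [div_lt_iff₀ hη0] at this
    linarith
  have h3 : (N : ℝ) ^ 2 * η ≤ 4 * c * N + 2 * c ^ 2 := by
    rw [hη]; nlinarith
  nlinarith [sq_nonneg c]


lemma lattice_closed : IsClosed (intLattice : Set R2) := by
  have : (intLattice : Set R2) = ⋂ i, (fun z : R2 => z i) ⁻¹' range ((↑) : ℤ → ℝ) := by
    ext z
    simp only [SetLike.mem_coe, mem_iInter, mem_preimage, mem_range]
    constructor
    · intro h i
      obtain ⟨n, hn⟩ := h i
      exact ⟨n, hn.symm⟩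
    · intro h i
      obtain ⟨n, hn⟩ := h i
      exact ⟨n, hn.symm⟩
  rw [this]
  apply isClosed_iInter
  intro i
  exact Int.isClosedEmbedding_coe_real.isClosed_range.preimage
    (by fun_prop : Continuous fun z : R2 => z i)

lemma closing (G : R2 ≃ₜ R2) (hG : Equi G) (y : R2) (m : ℕ) (hm : 0 < m) (w : R2)
    (hav : ∀ l, 0 < l → l < m → ∀ w' ∈ intLattice,
      (⇑G)^[l] y + w' ∉ segment ℝ ((⇑G)^[m] y) (y + w)) :
    ∃ G' : R2 ≃ₜ R2, Equi G' ∧ (⇑G')^[m] y = y + w ∧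
      ∀ z, ‖G' z - G z‖ ≤ ‖y + w - (⇑G)^[m] y‖ := by
  set C : Set R2 := ⋃ l ∈ Finset.Ioo 0 m, (fun z => z - (⇑G)^[l] y) ⁻¹' (intLattice : Set R2) with hC
  have hCc : IsClosed C := by
    apply isClosed_biUnion_finset
    intro l _
    exact lattice_closed.preimage (by fun_prop)
  have hmem : ∀ z, z ∈ C ↔ ∃ l, (0 < l ∧ l < m) ∧ z - (⇑G)^[l] y ∈ intLattice := by
    intro z
    simp [hC]
  obtain ⟨h, h1, h2, h3, h4⟩ := seg_move ((⇑G)^[m] y) (y + w) C hCc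
    (by
      intro z hz w' hw'
      rw [hmem] at hz ⊢
      obtain ⟨l, hl, hz⟩ := hz
      refine ⟨l, hl, ?_⟩
      have := add_mem hz hw'
      convert this using 1
      abel)
    (by
      rw [Set.disjoint_right]
      intro z hz hs
      rw [hmem] at hz
      obtain ⟨l, hl, hz⟩ := hz
      apply hav l hl.1 hl.2 _ hz
      convert hs using 1
      abel)
  have hit : ∀ l < m, (⇑(G.trans h))^[l] y = (⇑G)^[l] y := by
    intro l
    induction l with
    | zero => intro _; rfl
    | succ l ih =>
      intro hl
      rw [Function.iterate_succ_apply', ih (by omega), Homeomorph.trans_apply,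
        ← Function.iterate_succ_apply' (⇑G)]
      apply h3
      rw [hmem]
      exact ⟨l + 1, ⟨by omega, hl⟩, by simp⟩
  refine ⟨G.trans h, Equi.comp (F := h) (G := G) h1 hG, ?_, fun z => h4 (G z)⟩
  obtain ⟨k, rfl⟩ : ∃ k, m = k + 1 := ⟨m - 1, by omega⟩
  rw [Function.iterate_succ_apply', hit k (by omega), Homeomorph.trans_apply,
    ← Function.iterate_succ_apply' (⇑G), h2]

lemma div_lemma (p₁ p₂ q : ℤ) (hq : 1 < q) (hgcd : Int.gcd p₁ (Int.gcd p₂ q) = 1) (v : R2)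
    (hv0 : v 0 = (p₁ : ℝ) / (q : ℝ)) (hv1 : v 1 = (p₂ : ℝ) / (q : ℝ)) (k : ℕ) (hk : 0 < k)
    (w : Fin 2 → ℤ) (h : (k : ℝ)⁻¹ • iv w = v) : q ∣ (k : ℤ) := by
  have hqR : (q : ℝ) ≠ 0 := by
    have : q ≠ 0 := by omega
    exact_mod_cast this
  have hkR : (k : ℝ) ≠ 0 := by exact_mod_cast hk.ne'
  have e0 : (k : ℤ) * p₁ = q * w 0 := by
    have := congrArg (fun z : R2 => z 0) h
    simp only [PiLp.smul_apply, iv_apply, smul_eq_mul] at this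
    rw [hv0] at this
    field_simp at this
    have h2 : (k : ℝ) * p₁ = q * w 0 := by linarith
    exact_mod_cast h2
  have e1 : (k : ℤ) * p₂ = q * w 1 := by
    have := congrArg (fun z : R2 => z 1) h
    simp only [PiLp.smul_apply, iv_apply, smul_eq_mul] at this
    rw [hv1] at this
    field_simp at this
    have h2 : (k : ℝ) * p₂ = q * w 1 := by linarith
    exact_mod_cast h2
  have b1 := Int.gcd_eq_gcd_ab p₁ (Int.gcd p₂ q)
  have b2 := Int.gcd_eq_gcd_ab p₂ q
  rw [hgcd] at b1
  set a := Int.gcdA p₁ (Int.gcd p₂ q)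
  set b := Int.gcdB p₁ (Int.gcd p₂ q)
  set c := Int.gcdA p₂ q
  set d := Int.gcdB p₂ q
  refine ⟨w 0 * a + w 1 * c * b + k * d * b, ?_⟩
  have : (k : ℤ) = k * (p₁ * a + (p₂ * c + q * d) * b) := by
    rw [← b2, ← b1]; simp
  calc (k : ℤ) = k * (p₁ * a + (p₂ * c + q * d) * b) := this
    _ = (k * p₁) * a + (k * p₂) * c * b + q * k * d * b := by ring
    _ = _ := by rw [e0, e1]; ring

lemma seg_norm {a b z : R2} (h : z ∈ segment ℝ a b) : ‖z - a‖ + ‖b - z‖ = ‖b - a‖ := by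
  have := dist_add_dist_of_mem_segment h
  rw [dist_comm a z, dist_comm z b, dist_comm a b, dist_eq_norm, dist_eq_norm, dist_eq_norm] at this
  exact this

lemma step_B (K : Set R2) (G : R2 ≃ₜ R2) (hG : Equi G) (v : R2) (hv : v ∈ Set.extremePoints ℝ K)
    (d : ℝ) (hst : ∀ G' : R2 ≃ₜ R2, Equi G' → (∀ z, ‖G' z - G z‖ ≤ d) → rotSet G' ⊆ K)
    (x : R2) (n : ℕ) (w₀ : Fin 2 → ℤ) (hn : 0 < n) (hper : (⇑G)^[n] x = x + iv w₀)
    (hvw : (n : ℝ)⁻¹ • iv w₀ = v)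
    (hdist : ∀ i < n, ∀ j < n, (⇑G)^[i] x - (⇑G)^[j] x ∈ intLattice → i = j)
    (q : ℤ) (hq : ∀ k : ℕ, 0 < k → ∀ w : Fin 2 → ℤ, (k : ℝ)⁻¹ • iv w = v → q ∣ (k : ℤ))
    (hne : ∃ i j, i < j ∧ j < n ∧ ¬ q ∣ (j : ℤ) - i ∧
      ∃ w ∈ intLattice, ‖(⇑G)^[i] x + w - (⇑G)^[j] x‖ < d) : False := by
  set X : ℕ → R2 := fun i => (⇑G)^[i] x with hX
  set T : Set (ℕ × ℕ × (Fin 2 → ℤ)) := {p | p.1 < p.2.1 ∧ p.2.1 < n ∧ ¬ q ∣ (p.2.1 : ℤ) - p.1 ∧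
    ‖X p.1 + iv p.2.2 - X p.2.1‖ < d} with hT
  obtain ⟨A, hA⟩ : ∃ A : ℝ, ∀ k < n, ‖X k‖ ≤ A := by
    refine ⟨∑ k ∈ Finset.range n, ‖X k‖, fun k hk => ?_⟩
    exact Finset.single_le_sum (f := fun k => ‖X k‖) (fun _ _ => norm_nonneg _)
      (Finset.mem_range.2 hk)
  obtain ⟨R, hR⟩ := exists_nat_gt (d + 2 * A)
  have hTfin : T.Finite := by
    have hfin : ((Set.Iio n) ×ˢ (Set.Iio n) ×ˢ (Set.Icc (fun _ => -(R : ℤ)) (fun _ => (R : ℤ)) :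
      Set (Fin 2 → ℤ))).Finite :=
      (Set.finite_Iio _).prod ((Set.finite_Iio _).prod (Set.finite_Icc _ _))
    refine hfin.subset ?_
    rintro ⟨i, j, w⟩ ⟨h1, h2, -, h4⟩
    simp only at h1 h2 h4
    have hb : ∀ κ, |w κ| ≤ R := by
      intro κ
      have a1 := abs_coord_le (iv w) κ
      rw [iv_apply] at a1
      have a2 : iv w = (X i + iv w - X j) - X i + X j := by abel
      have a3 : ‖iv w‖ ≤ ‖X i + iv w - X j‖ + ‖X i‖ + ‖X j‖ := by
        calc ‖iv w‖ = ‖(X i + iv w - X j) - X i + X j‖ := by rw [← a2]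
          _ ≤ ‖(X i + iv w - X j) - X i‖ + ‖X j‖ := norm_add_le _ _
          _ ≤ _ := by gcongr; exact norm_sub_le _ _
      have a4 := hA i (by omega)
      have a5 := hA j h2
      have a6 : |(w κ : ℝ)| ≤ R := by linarith
      exact_mod_cast a6
    exact ⟨(by simp only [mem_Iio]; omega), h2, fun κ => (abs_le.1 (hb κ)).1,
      fun κ => (abs_le.1 (hb κ)).2⟩
  have hTne : T.Nonempty := by
    obtain ⟨i, j, hij, hj, hqq, w, hw, hlt⟩ := hne
    obtain ⟨k, rfl⟩ := (mem_iff_iv w).1 hw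
    exact ⟨(i, j, k), hij, hj, hqq, hlt⟩
  obtain ⟨⟨i, j, w⟩, ⟨hij, hj, hqij, hlt⟩, hmin⟩ :=
    Set.exists_min_image T (fun p => ‖X p.1 + iv p.2.2 - X p.2.1‖) hTfin hTne
  simp only at hij hj hqij hlt
  set μ := ‖X i + iv w - X j‖ with hμ
  have hmin1 : ∀ a b, a < b → b < n → ¬ q ∣ (b : ℤ) - a → ∀ k : Fin 2 → ℤ,
      μ ≤ ‖X a + iv k - X b‖ := by
    intro a b hab hb hqab k
    by_cases h : ‖X a + iv k - X b‖ < d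
    · exact hmin (a, b, k) ⟨hab, hb, hqab, h⟩
    · push Not at h; linarith
  have hmin2 : ∀ a b, a < n → b < n → ¬ q ∣ (b : ℤ) - a → ∀ k : R2, k ∈ intLattice →
      μ ≤ ‖X a + k - X b‖ := by
    intro a b ha hb hqab k hk
    rcases lt_trichotomy a b with h | h | h
    · obtain ⟨k, rfl⟩ := (mem_iff_iv k).1 hk
      exact hmin1 a b h hb hqab k
    · subst h; simp at hqab
    · obtain ⟨k', hk'⟩ := (mem_iff_iv (-k)).1 (neg_mem hk)
      have := hmin1 b a h ha (by rwa [dvd_sub_comm]) k'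
      rw [← hk'] at this
      have e : X a + k - X b = -(X b + -k - X a) := by abel
      rw [e, norm_neg]; exact this
  -- no other point of the cycle lies on the segment
  have hseg : ∀ l < n, l ≠ i → l ≠ j → ∀ w' ∈ intLattice,
      X l + w' ∉ segment ℝ (X j) (X i + iv w) := by
    intro l hl hli hlj w' hw' hs
    have h1 := seg_norm hs
    rw [← hμ] at h1
    have h2 : ‖X l + w' - X j‖ ≠ 0 := by
      intro h0
      rw [norm_eq_zero] at h0
      apply hlj
      apply hdist l hl j hj
      have : X l - X j = -w' := by rw [eq_neg_iff_add_eq_zero, ← h0]; abel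
      change X l - X j ∈ intLattice
      rw [this]; exact neg_mem hw'
    have h3 : ‖X i + iv w - (X l + w')‖ ≠ 0 := by
      intro h0
      rw [norm_eq_zero] at h0
      apply hli
      apply hdist l hl i (by omega)
      have : X l - X i = iv w - w' := by
        rw [← sub_eq_zero, ← neg_eq_zero, ← h0]; abel
      change X l - X i ∈ intLattice
      rw [this]; exact sub_mem (iv_mem _) hw'
    have h2' := lt_of_le_of_ne (norm_nonneg _) h2.symm
    have h3' := lt_of_le_of_ne (norm_nonneg _) h3.symm
    by_cases hc : q ∣ (j : ℤ) - l
    · have hc' : ¬ q ∣ (l : ℤ) - i := by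
        intro h
        apply hqij
        have := dvd_add hc h
        have e : (j : ℤ) - i = (j - l) + (l - i) := by ring
        rw [e]; exact this
      have h4 := hmin2 i l (by omega) hl hc' (iv w - w') (sub_mem (iv_mem _) hw')
      have e : X i + (iv w - w') - X l = X i + iv w - (X l + w') := by abel
      rw [e] at h4
      linarith
    · have h4 := hmin2 l j hl hj hc w' hw'
      linarith
  have hXadd : ∀ a b, (⇑G)^[a] (X b) = X (a + b) := fun a b =>
    (Function.iterate_add_apply (⇑G) a b x).symm
  have hXper : ∀ a, X (a + n) = X a + iv w₀ := by
    intro a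
    simp only [hX]
    rw [Function.iterate_add_apply, hper, hG.iterate a _ _ (iv_mem _)]
  -- inner loop
  have hin : ((j - i : ℕ) : ℝ)⁻¹ • iv w ∈ K := by
    obtain ⟨G', g1, g2, g3⟩ := closing G hG (X i) (j - i) (by omega) (iv w) (by
      intro l hl0 hl w' hw'
      rw [hXadd, hXadd, Nat.sub_add_cancel hij.le]
      exact hseg (l + i) (by omega) (by omega) (by omega) w' hw')
    rw [hXadd, Nat.sub_add_cancel hij.le] at g3
    exact hst G' g1 (fun z => (g3 z).trans hlt.le) (per_rot G' g1 (by omega) (iv_mem w) g2)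
  -- outer loop
  have hout : ((n - (j - i) : ℕ) : ℝ)⁻¹ • iv (w₀ - w) ∈ K := by
    have e1 : n - (j - i) + j = i + n := by omega
    have hivs : iv (w₀ - w) = iv w₀ - iv w := by ext κ; simp
    obtain ⟨G', g1, g2, g3⟩ := closing G hG (X j) (n - (j - i)) (by omega) (iv (w₀ - w)) (by
      intro l hl0 hl w' hw' hs
      rw [hXadd, hXadd, e1, hXper] at hs
      have hs2 : X (l + j) + w' - iv (w₀ - w) ∈ segment ℝ (X j) (X i + iv w) := by
        rw [segment_symm]
        rw [← mem_segment_translate ℝ (iv (w₀ - w))]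
        have a1 : iv (w₀ - w) + (X (l + j) + w' - iv (w₀ - w)) = X (l + j) + w' := by abel
        have a2 : iv (w₀ - w) + (X i + iv w) = X i + iv w₀ := by rw [hivs]; abel
        rw [a1, a2, add_comm _ (X j)]
        exact hs
      by_cases hlj : l + j < n
      · apply hseg (l + j) hlj (by omega) (by omega) (w' - iv (w₀ - w)) (sub_mem hw' (iv_mem _))
        rwa [← add_sub_assoc]
      · have e2 : l + j = (l + j - n) + n := by omega
        rw [e2, hXper] at hs2
        apply hseg (l + j - n) (by omega) (by omega) (by omega) (iv w₀ + w' - iv (w₀ - w))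
          (sub_mem (add_mem (iv_mem _) hw') (iv_mem _))
        convert hs2 using 1
        abel)
    rw [hXadd, e1, hXper] at g3
    have e3 : X j + iv (w₀ - w) - (X i + iv w₀) = -(X i + iv w - X j) := by rw [hivs]; abel
    rw [e3, norm_neg] at g3
    exact hst G' g1 (fun z => (g3 z).trans hlt.le)
      (per_rot G' g1 (by omega) (iv_mem _) g2)
  have hmR : (0 : ℝ) < (j - i : ℕ) := by exact_mod_cast (by omega : 0 < j - i)
  have hmR' : (0 : ℝ) < (n - (j - i) : ℕ) := by exact_mod_cast (by omega : 0 < n - (j - i))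
  have hnR : (0 : ℝ) < n := by exact_mod_cast hn
  have hsum : (((j - i : ℕ) : ℝ)) + ((n - (j - i) : ℕ) : ℝ) = n := by
    exact_mod_cast (by omega : (j - i) + (n - (j - i)) = n)
  have hopen : v ∈ openSegment ℝ (((j - i : ℕ) : ℝ)⁻¹ • iv w)
      (((n - (j - i) : ℕ) : ℝ)⁻¹ • iv (w₀ - w)) := by
    refine ⟨((j - i : ℕ) : ℝ) / n, ((n - (j - i) : ℕ) : ℝ) / n, by positivity, by positivity, ?_, ?_⟩
    · rw [← add_div, hsum, div_self hnR.ne']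
    · rw [← hvw]
      ext κ
      simp only [PiLp.add_apply, PiLp.smul_apply, iv_apply, smul_eq_mul, Pi.sub_apply]
      push_cast
      field_simp
      ring
  have heq := hv.2 hin hout hopen
  apply hqij
  have := hq (j - i) (by omega) w heq
  rwa [Nat.cast_sub hij.le] at this

/-- If `ρ(F)` has an extremal point `(p₁/q, p₂/q)` with `q > 1` and
`gcd(p₁, p₂, q) = 1`, then the rotation set of `f` is not `(2/√(πq))`-upper-stable
in `Homeo₀(T²)`. -/
theorem not_upper_stable_of_extreme_point (f : T2 ≃ₜ T2) (hf : f ∈ Homeo0)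
    (F : R2 ≃ₜ R2) (hF : IsLift f F) (p₁ p₂ q : ℤ) (hq : 1 < q)
    (hgcd : Int.gcd p₁ (Int.gcd p₂ q) = 1)
    (v : R2) (hv : v ∈ Set.extremePoints ℝ (rotSet F))
    (hv0 : v 0 = (p₁ : ℝ) / (q : ℝ)) (hv1 : v 1 = (p₂ : ℝ) / (q : ℝ)) :
    ∃ g ∈ Homeo0, ∃ G : R2 ≃ₜ R2, IsLift g G ∧
      supDist (⇑F) (⇑G) < 2 / Real.sqrt (Real.pi * (q : ℝ)) ∧
      ¬ rotSet G ⊆ rotSet F := by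
  have hE : Equi F := hF.equivariant
  have hpi := Real.pi_pos
  have hpi3 := Real.pi_gt_three
  have hqR : (1 : ℝ) < q := by exact_mod_cast hq
  have hq2 : (2 : ℝ) ≤ q := by exact_mod_cast hq
  set δ : ℝ := 2 / Real.sqrt (Real.pi * (q : ℝ)) with hδ
  have hpq : 0 < Real.pi * (q : ℝ) := by positivity
  have hs0 : 0 < Real.sqrt (Real.pi * (q : ℝ)) := Real.sqrt_pos.2 hpq
  have hδ0 : 0 < δ := by positivity
  have hδ2 : Real.pi * q * δ ^ 2 = 4 := by
    rw [hδ, div_pow, Real.sq_sqrt hpq.le]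
    field_simp
    norm_num
  by_contra hcon
  have hst : ∀ G : R2 ≃ₜ R2, Equi G → ∀ D < δ, (∀ z, ‖G z - F z‖ ≤ D) → rotSet G ⊆ rotSet F := by
    intro G hG D hD hGF
    by_contra hn
    obtain ⟨g, hg⟩ := exists_tor G hG
    exact hcon ⟨g, ⟨G, hg⟩, G, hg, lt_of_le_of_lt (supDist_le _ _ D hGF) hD, hn⟩
  obtain ⟨M, hM⟩ := exists_nat_gt (2 / (0.001 * δ))
  have hM0 : (0 : ℝ) < M := lt_trans (by positivity) hM
  have hMd : 2 / (M : ℝ) < 0.001 * δ := by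
    rw [div_lt_iff₀ (by positivity)] at hM
    rw [div_lt_iff₀ hM0]
    linarith
  obtain ⟨G, x, n, w₀, hG, hGF, hn, hper, hvw, hdist⟩ := step_A F hE v hv M (by exact_mod_cast hM0)
    (fun G hG hGF => hst G hG _ (by linarith) hGF)
  have hdiv : ∀ k : ℕ, 0 < k → ∀ w : Fin 2 → ℤ, (k : ℝ)⁻¹ • iv w = v → q ∣ (k : ℤ) :=
    fun k hk w h => div_lemma p₁ p₂ q hq hgcd v hv0 hv1 k hk w h
  have hqn : q ≤ n := Int.le_of_dvd (by exact_mod_cast hn) (hdiv n hn w₀ hvw)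
  obtain ⟨Q, rfl⟩ : ∃ Q : ℕ, q = Q := ⟨q.toNat, by omega⟩
  rw [Int.cast_natCast] at *
  refine step_B (rotSet F) G hG v hv (0.999 * δ) ?_ x n w₀ hn hper hvw hdist (Q : ℤ) hdiv ?_
  · intro G' hG' h
    refine hst G' hG' (0.999 * δ + 2 / M) (by linarith) ?_
    intro z
    have : G' z - F z = (G' z - G z) + (G z - F z) := by abel
    rw [this]
    exact (norm_add_le _ _).trans (add_le_add (h z) (hGF z))
  · obtain ⟨i, j, hij, hj, w, hw, hlt⟩ := packing Q (fun i => (⇑G)^[i] x) (0.999 * δ)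
      (by positivity) (by
        have : δ ≤ 1 := by
          by_contra h
          push Not at h
          have h6 : 6 ≤ Real.pi * (Q : ℝ) := by nlinarith
          have h7 : 1 < δ ^ 2 := by nlinarith
          nlinarith
        linarith) (by
          have e : 1.01 * Real.pi * Q * (0.999 * δ) ^ 2 =
              1.01 * 0.999 ^ 2 * (Real.pi * Q * δ ^ 2) := by ring
          rw [e, hδ2]; norm_num)
    refine ⟨i, j, hij, by omega, ?_, w, hw, hlt⟩
    intro hd
    have := Int.le_of_dvd (by omega) hd
    omega
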